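/- Fix 0 < c ≤ M and let (ρ, m) ∈ L^∞([0,T] × ℝ; K) be an entropy solution in K of the isentropic Euler system with γ = 3. Then (ρ, m) belongs to B^{1/2,1}_{∞,loc} in the space variable, locally in time away from t = 0: for every δ ∈ (0, T) and every compact K' ⊂ ℝ there exists a constant C such that sup_{h>0} ∫_δ^T ∫_{K'} ( |ρ(t, x+h) − ρ(t, x)| + |m(t, x+h) − m(t, x)| ) / h^{1/2} dx dt ≤ C. -/

import Mathlib

open MeasureTheory Topology Filter Set
open scoped ENNReal NNReal

noncomputable section

/-- A locally finite signed Radon measure, represented by its (unique) Jordan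
decomposition: a mutually singular pair of locally finite positive measures. -/
structure LocSigned (X : Type*) [TopologicalSpace X] [MeasurableSpace X] where
  pos : Measure X
  neg : Measure X
  posLF : IsLocallyFiniteMeasure pos
  negLF : IsLocallyFiniteMeasure neg
  sing : Measure.MutuallySingular pos neg

namespace LocSigned

variable {X : Type*} [TopologicalSpace X] [MeasurableSpace X]

/-- Integral of a function against a signed measure. -/
def integral (μ : LocSigned X) (φ : X → ℝ) : ℝ :=
  (∫ x, φ x ∂μ.pos) - ∫ x, φ x ∂μ.neg

/-- Total variation measure `|μ|`. -/
def tv (μ : LocSigned X) : Measure X := μ.pos + μ.neg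

end LocSigned

/-- Smooth real test functions compactly supported in `Ω`. -/
def IsTestFun {E : Type*} [NormedAddCommGroup E] [NormedSpace ℝ E]
    (Ω : Set E) (φ : E → ℝ) : Prop :=
  ContDiff ℝ (⊤ : ℕ∞) φ ∧ HasCompactSupport φ ∧ tsupport φ ⊆ Ω

/-- The compact state space `K = {(ρ,m) : |(ρ,m)| ≤ M, ρ ≥ c}`. -/
def Kset (c M : ℝ) : Set (ℝ × ℝ) := {p | ‖p‖ ≤ M ∧ c ≤ p.1}

/-- The time-slab `Ω = (0,T) × ℝ`. -/
def Slab1 (T : ℝ) : Set (ℝ × ℝ) := {p | p.1 ∈ Set.Ioo 0 T}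

/-- The slab `(0,T) × ℝ × ℝ` in kinetic variables. -/
def SlabExt1 (T : ℝ) : Set (ℝ × ℝ × ℝ) := {p | p.1 ∈ Set.Ioo 0 T}

/-- The projection `p_{t,x}(t,x,v) = (t,x)`. -/
def projTX1 : ℝ × ℝ × ℝ → ℝ × ℝ := fun p => (p.1, p.2.1)

/-- The flux of the isentropic Euler system with `γ = 3`:
`f(ρ, m) = (m, m²/ρ + ρ³/3)`. -/
def eulerFlux : ℝ × ℝ → ℝ × ℝ := fun p => (p.2, p.2 ^ 2 / p.1 + p.1 ^ 3 / 3)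

/-- `U = (ρ, m)` is an entropy solution in `K` of the isentropic Euler system with
`γ = 3` on `(0,T) × ℝ`: a distributional solution dissipating every convex `C²`
entropy on `K`. -/
def IsEntropySolK (c M T : ℝ) (U : ℝ × ℝ → ℝ × ℝ) : Prop :=
  Measurable U ∧ (∀ p, U p ∈ Kset c M) ∧
  (∀ φ : ℝ × ℝ → ℝ, IsTestFun (Slab1 T) φ →
    (∫ p in Slab1 T,
      ((U p).1 * fderiv ℝ φ p (1, 0) + (U p).2 * fderiv ℝ φ p (0, 1))) = 0 ∧
    (∫ p in Slab1 T,
      ((U p).2 * fderiv ℝ φ p (1, 0)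
        + ((U p).2 ^ 2 / (U p).1 + (U p).1 ^ 3 / 3) * fderiv ℝ φ p (0, 1))) = 0) ∧
  (∀ η Q : ℝ × ℝ → ℝ,
    ContDiffOn ℝ 2 η (Kset c M) → ConvexOn ℝ (Kset c M) η →
    ContDiffOn ℝ 2 Q (Kset c M) →
    (∀ p ∈ Kset c M,
      fderivWithin ℝ Q (Kset c M) p
        = (fderivWithin ℝ η (Kset c M) p).comp (fderiv ℝ eulerFlux p)) →
    ∀ φ : ℝ × ℝ → ℝ, IsTestFun (Slab1 T) φ → (∀ p, 0 ≤ φ p) →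
      0 ≤ ∫ p in Slab1 T,
        (η (U p) * fderiv ℝ φ p (1, 0) + Q (U p) * fderiv ℝ φ p (0, 1)))

/-- The first Riemann invariant `w = m/ρ - ρ`. -/
def wInv (U : ℝ × ℝ → ℝ × ℝ) (p : ℝ × ℝ) : ℝ := (U p).2 / (U p).1 - (U p).1

/-- The second Riemann invariant `z = m/ρ + ρ`. -/
def zInv (U : ℝ × ℝ → ℝ × ℝ) (p : ℝ × ℝ) : ℝ := (U p).2 / (U p).1 + (U p).1

/-- The Riemann invariants `m/ρ + σ ρ`, `σ = ±1`, as functions of the state. -/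
def riemann (σ : ℝ) (p : ℝ × ℝ) : ℝ := p.2 / p.1 + σ * p.1

/-- The physical energy of the system. -/
def energy (p : ℝ × ℝ) : ℝ := p.2 ^ 2 / (2 * p.1) + p.1 ^ 3 / 6

/-- The flux of the physical energy. -/
def energyFlux (p : ℝ × ℝ) : ℝ := p.2 ^ 3 / (2 * p.1 ^ 2) + p.2 * p.1 ^ 2 / 2

lemma mem_Kset {c M : ℝ} {p : ℝ × ℝ} (hp : p ∈ Kset c M) :
    c ≤ p.1 ∧ p.1 ≤ M ∧ -M ≤ p.2 ∧ p.2 ≤ M := by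
  obtain ⟨h1, h2⟩ := hp
  rw [Prod.norm_def, sup_le_iff, Real.norm_eq_abs, Real.norm_eq_abs, abs_le, abs_le] at h1
  exact ⟨h2, h1.1.2, h1.2.1, h1.2.2⟩

lemma convex_Kset (c M : ℝ) : Convex ℝ (Kset c M) := by
  have : Kset c M = Metric.closedBall (0 : ℝ × ℝ) M ∩ Prod.fst ⁻¹' Set.Ici c := by
    ext p; simp [Kset]
  rw [this]
  exact (convex_closedBall _ _).inter
    ((convex_Ici c).is_linear_preimage (LinearMap.fst ℝ ℝ ℝ).isLinear)

lemma uniqueDiffOn_Kset {c M : ℝ} (hc : 0 < c) (hcM : c < M) : UniqueDiffOn ℝ (Kset c M) := by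
  refine uniqueDiffOn_convex (convex_Kset c M) ⟨((c + M) / 2, 0), ?_⟩
  rw [mem_interior]
  refine ⟨Set.Ioo c M ×ˢ Set.Ioo (-M) M, ?_, isOpen_Ioo.prod isOpen_Ioo, ?_⟩
  · rintro ⟨a, b⟩ ⟨⟨h1, h2⟩, h3, h4⟩
    simp only at h1 h2 h3 h4
    refine ⟨?_, h1.le⟩
    rw [Prod.norm_def, sup_le_iff, Real.norm_eq_abs, Real.norm_eq_abs, abs_le, abs_le]
    exact ⟨⟨by simp only; linarith, h2.le⟩, h3.le, h4.le⟩
  · refine ⟨⟨?_, ?_⟩, ?_, ?_⟩ <;> simp only <;> linarith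

lemma hasFDerivAt_fst_inv {p : ℝ × ℝ} (hp : p.1 ≠ 0) :
    HasFDerivAt (fun q : ℝ × ℝ => q.1⁻¹) ((-(p.1 ^ 2)⁻¹) • ContinuousLinearMap.fst ℝ ℝ ℝ) p :=
  (hasDerivAt_inv hp).comp_hasFDerivAt p hasFDerivAt_fst

lemma hasFDerivAt_riemann (σ : ℝ) {p : ℝ × ℝ} (hp : p.1 ≠ 0) :
    HasFDerivAt (riemann σ) ((σ - p.2 / p.1 ^ 2) • ContinuousLinearMap.fst ℝ ℝ ℝ
      + (1 / p.1) • ContinuousLinearMap.snd ℝ ℝ ℝ) p := by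
  have h1 : HasFDerivAt (fun q : ℝ × ℝ => q.1) (ContinuousLinearMap.fst ℝ ℝ ℝ) p := hasFDerivAt_fst
  have h2 : HasFDerivAt (fun q : ℝ × ℝ => q.2) (ContinuousLinearMap.snd ℝ ℝ ℝ) p := hasFDerivAt_snd
  refine ((h2.mul (hasFDerivAt_fst_inv hp)).add (h1.const_mul σ)).congr_fderiv ?_
    |>.congr_of_eventuallyEq ?_
  · ext <;> simp
    field_simp
    ring
  · refine Eventually.of_forall fun q => ?_
    simp [riemann, div_eq_mul_inv]

lemma hasFDerivAt_energy {p : ℝ × ℝ} (hp : p.1 ≠ 0) :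
    HasFDerivAt energy ((-p.2 ^ 2 / (2 * p.1 ^ 2) + p.1 ^ 2 / 2) • ContinuousLinearMap.fst ℝ ℝ ℝ
      + (p.2 / p.1) • ContinuousLinearMap.snd ℝ ℝ ℝ) p := by
  have h1 : HasFDerivAt (fun q : ℝ × ℝ => q.1) (ContinuousLinearMap.fst ℝ ℝ ℝ) p := hasFDerivAt_fst
  have h2 : HasFDerivAt (fun q : ℝ × ℝ => q.2) (ContinuousLinearMap.snd ℝ ℝ ℝ) p := hasFDerivAt_snd
  refine ((((h2.pow 2).mul (hasFDerivAt_fst_inv hp)).mul_const (1 / 2)).add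
    ((h1.pow 3).mul_const (1 / 6))).congr_fderiv ?_ |>.congr_of_eventuallyEq ?_
  · ext <;> simp <;> field_simp
    ring
  · refine Eventually.of_forall fun q => ?_
    simp [energy, div_eq_mul_inv]; ring

lemma hasFDerivAt_energyFlux {p : ℝ × ℝ} (hp : p.1 ≠ 0) :
    HasFDerivAt energyFlux ((-p.2 ^ 3 / p.1 ^ 3 + p.2 * p.1) • ContinuousLinearMap.fst ℝ ℝ ℝ
      + (3 * p.2 ^ 2 / (2 * p.1 ^ 2) + p.1 ^ 2 / 2) • ContinuousLinearMap.snd ℝ ℝ ℝ) p := by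
  have h1 : HasFDerivAt (fun q : ℝ × ℝ => q.1) (ContinuousLinearMap.fst ℝ ℝ ℝ) p := hasFDerivAt_fst
  have h2 : HasFDerivAt (fun q : ℝ × ℝ => q.2) (ContinuousLinearMap.snd ℝ ℝ ℝ) p := hasFDerivAt_snd
  refine ((((h2.pow 3).mul ((hasFDerivAt_fst_inv hp).pow 2)).mul_const (1 / 2)).add
    ((h2.mul (h1.pow 2)).mul_const (1 / 2))).congr_fderiv ?_ |>.congr_of_eventuallyEq ?_
  · ext <;> simp <;> field_simp
  · refine Eventually.of_forall fun q => ?_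
    simp [energyFlux, div_eq_mul_inv]; ring

lemma hasFDerivAt_eulerFlux {p : ℝ × ℝ} (hp : p.1 ≠ 0) :
    HasFDerivAt eulerFlux ((ContinuousLinearMap.snd ℝ ℝ ℝ).prod
      ((-p.2 ^ 2 / p.1 ^ 2 + p.1 ^ 2) • ContinuousLinearMap.fst ℝ ℝ ℝ
      + (2 * p.2 / p.1) • ContinuousLinearMap.snd ℝ ℝ ℝ)) p := by
  have h1 : HasFDerivAt (fun q : ℝ × ℝ => q.1) (ContinuousLinearMap.fst ℝ ℝ ℝ) p := hasFDerivAt_fst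
  have h2 : HasFDerivAt (fun q : ℝ × ℝ => q.2) (ContinuousLinearMap.snd ℝ ℝ ℝ) p := hasFDerivAt_snd
  refine HasFDerivAt.prodMk h2 ((((h2.pow 2).mul (hasFDerivAt_fst_inv hp)).add
    ((h1.pow 3).mul_const (1 / 3))).congr_fderiv ?_ |>.congr_of_eventuallyEq ?_)
  · ext <;> simp <;> field_simp
  · refine Eventually.of_forall fun q => ?_
    simp [div_eq_mul_inv]

lemma contDiffOn_riemann (σ : ℝ) {c M : ℝ} (hc : 0 < c) :
    ContDiffOn ℝ 2 (riemann σ) (Kset c M) := by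
  unfold riemann
  have : ∀ p ∈ Kset c M, p.1 ≠ 0 := fun p hp => (hc.trans_le hp.2).ne'
  fun_prop (disch := assumption)

lemma contDiffOn_energy {c M : ℝ} (hc : 0 < c) : ContDiffOn ℝ 2 energy (Kset c M) := by
  unfold energy
  have : ∀ p ∈ Kset c M, 2 * p.1 ≠ 0 := fun p hp => by
    have := hc.trans_le hp.2; positivity
  fun_prop (disch := assumption)

lemma contDiffOn_energyFlux {c M : ℝ} (hc : 0 < c) : ContDiffOn ℝ 2 energyFlux (Kset c M) := by
  unfold energyFlux
  have : ∀ p ∈ Kset c M, 2 * p.1 ^ 2 ≠ 0 := fun p hp => by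
    have := hc.trans_le hp.2; positivity
  fun_prop (disch := assumption)

/-- Convexity of `ρ ↦ C ρ³/6 - 1/(2Cρ)` on `ρ ≥ c` for `C = 1/c²`, in two-point form. -/
lemma cubic_sub_inv_convex {c x y s t : ℝ} (hc : 0 < c) (hx : c ≤ x) (hy : c ≤ y)
    (hs : 0 ≤ s) (ht : 0 ≤ t) (hst : s + t = 1) :
    (s * x + t * y) ^ 3 / (6 * c ^ 2) - c ^ 2 / (2 * (s * x + t * y)) ≤
      s * (x ^ 3 / (6 * c ^ 2) - c ^ 2 / (2 * x)) + t * (y ^ 3 / (6 * c ^ 2) - c ^ 2 / (2 * y)) := by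
  have hx0 := hc.trans_le hx
  have hy0 := hc.trans_le hy
  have hz : c ≤ s * x + t * y := by
    calc c = s * c + t * c := by rw [← add_mul, hst, one_mul]
      _ ≤ _ := by gcongr
  have hz0 := hc.trans_le hz
  obtain rfl : t = 1 - s := by linarith
  set z := s * x + (1 - s) * y with hzd
  have h : s * (x ^ 3 / (6 * c ^ 2) - c ^ 2 / (2 * x))
      + (1 - s) * (y ^ 3 / (6 * c ^ 2) - c ^ 2 / (2 * y))
      - (z ^ 3 / (6 * c ^ 2) - c ^ 2 / (2 * z))
      = s * (1 - s) * (x - y) ^ 2 * ((x + y + z) / (6 * c ^ 2) - c ^ 2 / (2 * (x * y * z))) := by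
    have h1 : s * x ^ 3 + (1 - s) * y ^ 3 - z ^ 3 = s * (1 - s) * (x - y) ^ 2 * (x + y + z) := by
      rw [hzd]; ring
    have h2 : s / x + (1 - s) / y - 1 / z = s * (1 - s) * (x - y) ^ 2 / (x * y * z) := by
      rw [div_add_div _ _ hx0.ne' hy0.ne', div_sub_div _ _ (by positivity) hz0.ne']
      congr 1
      rw [hzd]; ring
    calc _ = (s * x ^ 3 + (1 - s) * y ^ 3 - z ^ 3) / (6 * c ^ 2)
          - c ^ 2 / 2 * (s / x + (1 - s) / y - 1 / z) := by field_simp; ring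
      _ = _ := by rw [h1, h2]; field_simp
  have h3 : c ^ 2 / (2 * (x * y * z)) ≤ (x + y + z) / (6 * c ^ 2) := by
    have h4 : c ^ 3 ≤ x * y * z := by
      calc c ^ 3 = c * c * c := by ring
        _ ≤ _ := by gcongr
    rw [div_le_div_iff₀ (by positivity) (by positivity)]
    calc c ^ 2 * (6 * c ^ 2) = (c + c + c) * (2 * c ^ 3) := by ring
      _ ≤ _ := by gcongr
  have h5 : 0 ≤ s * (1 - s) * (x - y) ^ 2 *
      ((x + y + z) / (6 * c ^ 2) - c ^ 2 / (2 * (x * y * z))) :=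
    mul_nonneg (by positivity) (by linarith)
  linarith

/-- Joint convexity of `(ρ, m) ↦ m²/ρ` in two-point form. -/
lemma sq_div_convex {x y a b s t : ℝ} (hx : 0 < x) (hy : 0 < y)
    (hs : 0 ≤ s) (ht : 0 ≤ t) (hst : s + t = 1) :
    (s * a + t * b) ^ 2 / (s * x + t * y) ≤ s * (a ^ 2 / x) + t * (b ^ 2 / y) := by
  have hz : 0 < s * x + t * y := by
    rcases hs.eq_or_lt with h | h
    · have : t = 1 := by linarith
      subst h; subst this; linarith
    · positivity
  rw [div_le_iff₀ hz]
  have h : (s * (a ^ 2 / x) + t * (b ^ 2 / y)) * (s * x + t * y) - (s * a + t * b) ^ 2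
      = s * t * (a * y - b * x) ^ 2 / (x * y) := by
    field_simp; ring
  have : 0 ≤ s * t * (a * y - b * x) ^ 2 / (x * y) := by positivity
  linarith

lemma energy_add_riemann_convex {c M σ e : ℝ} (hc : 0 < c) (he : e ^ 2 = 1) :
    ConvexOn ℝ (Kset c M) (fun p => energy p / c ^ 2 + e * riemann σ p) := by
  refine ⟨convex_Kset c M, ?_⟩
  rintro ⟨x, a⟩ hp ⟨y, b⟩ hq s t hs ht hst
  have hx : c ≤ x := hp.2
  have hy : c ≤ y := hq.2
  have hx0 := hc.trans_le hx
  have hy0 := hc.trans_le hy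
  have hz : 0 < s * x + t * y := by
    calc 0 < c := hc
      _ = s * c + t * c := by rw [← add_mul, hst, one_mul]
      _ ≤ _ := by gcongr
  have key : ∀ u v : ℝ, 0 < u → energy (u, v) / c ^ 2 + e * riemann σ (u, v)
      = (v + e * c ^ 2) ^ 2 / u / (2 * c ^ 2) + (u ^ 3 / (6 * c ^ 2) - c ^ 2 / (2 * u))
        + e * σ * u := by
    intro u v hu
    simp only [energy, riemann]
    field_simp
    linear_combination (-(6 * c ^ 4)) * he
  simp only [Prod.smul_mk, Prod.mk_add_mk, smul_eq_mul]
  rw [key _ _ hz, key _ _ hx0, key _ _ hy0]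
  have h1 := cubic_sub_inv_convex hc hx hy hs ht hst
  have h2 := sq_div_convex (a := a + e * c ^ 2) (b := b + e * c ^ 2) hx0 hy0 hs ht hst
  have h3 : s * (a + e * c ^ 2) + t * (b + e * c ^ 2) = s * a + t * b + e * c ^ 2 := by
    linear_combination (e * c ^ 2) * hst
  rw [h3] at h2
  have h4 := div_le_div_of_nonneg_right h2 (by positivity : 0 ≤ 2 * c ^ 2)
  rw [add_div, mul_div_assoc, mul_div_assoc] at h4
  linarith

/-- A convex `1`-Lipschitz function of a Riemann invariant becomes convex after adding a fixed
multiple of the energy. -/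
lemma convexOn_comp_riemann {c M σ : ℝ} (hc : 0 < c) {A : ℝ → ℝ} (hA : ConvexOn ℝ univ A)
    (hL : ∀ x y, |A x - A y| ≤ |x - y|) (d : ℝ) :
    ConvexOn ℝ (Kset c M) (fun p => A (riemann σ p) + energy p / c ^ 2 + d) := by
  refine ⟨convex_Kset c M, fun p hp q hq s t hs ht hst => ?_⟩
  have h1 := (energy_add_riemann_convex (σ := σ) hc (by norm_num : (1 : ℝ) ^ 2 = 1)).2
    hp hq hs ht hst
  have h2 := (energy_add_riemann_convex (σ := σ) hc (by norm_num : (-1 : ℝ) ^ 2 = 1)).2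
    hp hq hs ht hst
  simp only [smul_eq_mul] at h1 h2 ⊢
  have h3 := hA.2 (mem_univ (riemann σ p)) (mem_univ (riemann σ q)) hs ht hst
  simp only [smul_eq_mul] at h3
  have h4 := hL (riemann σ (s • p + t • q)) (s * riemann σ p + t * riemann σ q)
  have h5 : |riemann σ (s • p + t • q) - (s * riemann σ p + t * riemann σ q)|
      ≤ s * (energy p / c ^ 2) + t * (energy q / c ^ 2) - energy (s • p + t • q) / c ^ 2 := by
    rw [abs_le]; constructor <;> linarith
  have h6 := (le_abs_self _).trans (h4.trans h5)
  have h7 : d = s * d + t * d := by rw [← add_mul, hst, one_mul]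
  linarith

/-- The entropy inequality for functions of a single Riemann invariant, corrected by the energy. -/
lemma IsEntropySolK.riemann_entropy_ineq {c M T σ : ℝ} {U : ℝ × ℝ → ℝ × ℝ}
    (hU : IsEntropySolK c M T U) (hc : 0 < c) (hcM : c < M) (hσ : σ ^ 2 = 1)
    {A q : ℝ → ℝ} (hA : ContDiff ℝ 2 A) (hq : ContDiff ℝ 2 q) (hconv : ConvexOn ℝ univ A)
    (hL : ∀ x y, |A x - A y| ≤ |x - y|) (hqA : ∀ s, deriv q s = s * deriv A s) (d₁ d₂ : ℝ)
    {φ : ℝ × ℝ → ℝ} (hφ : IsTestFun (Slab1 T) φ) (hφ0 : ∀ p, 0 ≤ φ p) :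
    0 ≤ ∫ p in Slab1 T,
      ((A (riemann σ (U p)) + energy (U p) / c ^ 2 + d₁) * fderiv ℝ φ p (1, 0)
        + (q (riemann σ (U p)) + energyFlux (U p) / c ^ 2 + d₂) * fderiv ℝ φ p (0, 1)) := by
  refine hU.2.2.2 (fun p => A (riemann σ p) + energy p / c ^ 2 + d₁)
    (fun p => q (riemann σ p) + energyFlux p / c ^ 2 + d₂) ?_
    (convexOn_comp_riemann hc hconv hL d₁) ?_ ?_ φ hφ hφ0
  · exact ((hA.comp_contDiffOn (contDiffOn_riemann σ hc)).add
      ((contDiffOn_energy hc).div_const _)).add contDiffOn_const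
  · exact ((hq.comp_contDiffOn (contDiffOn_riemann σ hc)).add
      ((contDiffOn_energyFlux hc).div_const _)).add contDiffOn_const
  · intro p hp
    have hp0 : p.1 ≠ 0 := (hc.trans_le hp.2).ne'
    have huniq := uniqueDiffOn_Kset hc hcM p hp
    have e1 := ((((hA.differentiable (by norm_num)) (riemann σ p)).hasDerivAt.comp_hasFDerivAt p
      (hasFDerivAt_riemann σ hp0)).add ((hasFDerivAt_energy hp0).mul_const (c ^ 2)⁻¹)).add_const d₁
    have e2 := ((((hq.differentiable (by norm_num)) (riemann σ p)).hasDerivAt.comp_hasFDerivAt p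
      (hasFDerivAt_riemann σ hp0)).add
        ((hasFDerivAt_energyFlux hp0).mul_const (c ^ 2)⁻¹)).add_const d₂
    have e1' : HasFDerivAt (fun p => A (riemann σ p) + energy p / c ^ 2 + d₁) _ p := e1
    have e2' : HasFDerivAt (fun p => q (riemann σ p) + energyFlux p / c ^ 2 + d₂) _ p := e2
    rw [e1'.hasFDerivWithinAt.fderivWithin huniq, e2'.hasFDerivWithinAt.fderivWithin huniq,
      (hasFDerivAt_eulerFlux hp0).fderiv, hqA]
    generalize deriv A (riemann σ p) = a
    ext <;> simp [riemann] <;> field_simp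
    · linear_combination (c ^ 2 * p.1 ^ 4 * a) * hσ
    · ring

/-- Existence of convex regularisations of the positive part which make the Burgers entropy flux
difference strictly dissipative. -/
lemma exists_entropy_profile {ε : ℝ} (hε : 0 < ε) : ∃ f F : ℝ → ℝ,
    ContDiff ℝ 2 f ∧ ContDiff ℝ 2 F ∧ (∀ d, deriv F d = f d) ∧ ConvexOn ℝ univ f ∧
    (∀ x y, |f x - f y| ≤ |x - y|) ∧ (∀ d, 0 ≤ f d) ∧ (∀ d, 0 ≤ F d) ∧ (∀ d, d - 2 * ε ≤ f d) ∧
    (∀ d, f d ≤ |d|) ∧ (∀ d, ε * f d ≤ d * f d - 2 * F d) := by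
  set S : ℝ → ℝ := fun s => Real.smoothTransition (s / ε - 1) with hS
  have hScont : ContDiff ℝ 2 S :=
    (Real.smoothTransition.contDiff (n := 2)).comp ((contDiff_id.div_const ε).sub contDiff_const)
  have hS0 : ∀ s, 0 ≤ S s := fun s => Real.smoothTransition.nonneg _
  have hS1 : ∀ s, S s ≤ 1 := fun s => Real.smoothTransition.le_one _
  have hSm : Monotone S := fun x y hxy => Real.smoothTransition.monotone (by gcongr)
  have hSz : ∀ s ≤ ε, S s = 0 := fun s hs =>
    Real.smoothTransition.zero_of_nonpos (by rw [sub_nonpos, div_le_one hε]; exact hs)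
  have hSo : ∀ s, 2 * ε ≤ s → S s = 1 := fun s hs =>
    Real.smoothTransition.one_of_one_le (by rw [le_sub_iff_add_le, le_div_iff₀ hε]; linarith)
  set f : ℝ → ℝ := fun d => ∫ s in (0 : ℝ)..d, S s with hf
  have hfd : ∀ d, HasDerivAt f (S d) d := fun d =>
    hScont.continuous.integral_hasStrictDerivAt 0 d |>.hasDerivAt
  have hfdiff : Differentiable ℝ f := fun d => (hfd d).differentiableAt
  have hfd' : deriv f = S := funext fun d => (hfd d).deriv
  have hfC : ContDiff ℝ 2 f := by
    have : ContDiff ℝ (1 + 1) f := contDiff_succ_iff_deriv.2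
      ⟨hfdiff, by simp, by rw [hfd']; exact hScont.of_le (by norm_num)⟩
    exact this.of_le (by norm_num)
  set F : ℝ → ℝ := fun d => ∫ s in (0 : ℝ)..d, f s with hF
  have hFd : ∀ d, HasDerivAt F (f d) d := fun d =>
    hfC.continuous.integral_hasStrictDerivAt 0 d |>.hasDerivAt
  have hFdiff : Differentiable ℝ F := fun d => (hFd d).differentiableAt
  have hFd' : deriv F = f := funext fun d => (hFd d).deriv
  have hFC : ContDiff ℝ 2 F := by
    have : ContDiff ℝ (1 + 1) F := contDiff_succ_iff_deriv.2
      ⟨hFdiff, by simp, by rw [hFd']; exact hfC.of_le (by norm_num)⟩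
    exact this.of_le (by norm_num)
  have hfmono : Monotone f := monotone_of_deriv_nonneg hfdiff (by rw [hfd']; exact hS0)
  have hFmono0 : ∀ d, 0 ≤ d → 0 ≤ f d := fun d hd =>
    intervalIntegral.integral_nonneg hd fun s _ => hS0 s
  have hfz : ∀ d ≤ ε, f d = 0 := fun d hd => by
    have : ∀ s ∈ Set.uIcc 0 d, S s = 0 := fun s hs =>
      hSz s (hs.2.trans (max_le hε.le hd))
    simp only [hf]
    rw [intervalIntegral.integral_congr (g := fun _ => 0) this]; simp
  have hf0 : ∀ d, 0 ≤ f d := fun d => by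
    rcases le_total 0 d with h | h
    · exact hFmono0 d h
    · exact (hfz d (h.trans hε.le)).ge
  have hFz : ∀ d ≤ ε, F d = 0 := fun d hd => by
    have : ∀ s ∈ Set.uIcc 0 d, f s = 0 := fun s hs =>
      hfz s (hs.2.trans (max_le hε.le hd))
    simp only [hF]
    rw [intervalIntegral.integral_congr (g := fun _ => 0) this]; simp
  have hLip : ∀ x y, |f x - f y| ≤ |x - y| := by
    have : LipschitzWith 1 f := lipschitzWith_of_nnnorm_deriv_le hfdiff fun x => by
      rw [hfd', ← NNReal.coe_le_coe]
      simpa [abs_of_nonneg (hS0 x)] using hS1 x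
    intro x y
    have := this.dist_le_mul x y
    simpa [Real.dist_eq] using this
  have hGmono : ∀ d, ε ≤ d → f d ≤ (d - ε) * S d := by
    intro d hd
    have h1 : f d = f ε + ∫ s in ε..d, S s := by
      simp only [hf]
      rw [intervalIntegral.integral_add_adjacent_intervals] <;>
        exact hScont.continuous.intervalIntegrable _ _
    rw [h1, hfz ε le_rfl, zero_add]
    calc ∫ s in ε..d, S s ≤ ∫ _ in ε..d, S d :=
          intervalIntegral.integral_mono_on hd (hScont.continuous.intervalIntegrable _ _)
            (by simp) fun s hs => hSm hs.2
      _ = (d - ε) * S d := by simp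
  refine ⟨f, F, hfC, hFC, fun d => by rw [hFd'], ?_, hLip, hf0, ?_, ?_, ?_, ?_⟩
  · exact MonotoneOn.convexOn_of_deriv convex_univ hfC.continuous.continuousOn
      hfdiff.differentiableOn (by rw [hfd']; exact hSm.monotoneOn _)
  · intro d
    rcases le_total d ε with h | h
    · exact (hFz d h).ge
    · exact intervalIntegral.integral_nonneg (hε.le.trans h) fun s _ => hf0 s
  · intro d
    rcases le_total d (2 * ε) with h | h
    · linarith [hf0 d]
    · have h1 : f d = f (2 * ε) + ∫ s in (2 * ε)..d, S s := by
        simp only [hf]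
        rw [intervalIntegral.integral_add_adjacent_intervals] <;>
          exact hScont.continuous.intervalIntegrable _ _
      have h2 : ∫ s in (2 * ε)..d, S s = ∫ _ in (2 * ε)..d, (1 : ℝ) :=
        intervalIntegral.integral_congr fun s hs => hSo s (by
          rw [Set.uIcc_of_le h] at hs; exact hs.1)
      rw [h1, h2]
      simp [hf0]
  · intro d
    have := hLip d 0
    rw [hfz 0 hε.le, sub_zero, sub_zero] at this
    exact (le_abs_self _).trans this
  · have hm : Monotone fun d => d * f d - 2 * F d - ε * f d := by
      refine monotone_of_deriv_nonneg (by fun_prop) fun d => ?_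
      have : HasDerivAt (fun d => d * f d - 2 * F d - ε * f d)
          (1 * f d + d * S d - 2 * f d - ε * S d) d :=
        (((hasDerivAt_id d).mul (hfd d)).sub ((hFd d).const_mul 2)).sub ((hfd d).const_mul ε)
      rw [this.deriv]
      rcases le_total d ε with h | h
      · rw [hfz d h, hSz d h]; simp
      · have := hGmono d h; linarith
    intro d
    rcases le_total d ε with h | h
    · rw [hfz d h, hFz d h]; simp
    · have := hm h
      simp only [hfz ε le_rfl, hFz ε le_rfl] at this
      linarith

lemma IsTestFun.fderiv_eq_zero {E : Type*} [NormedAddCommGroup E] [NormedSpace ℝ E]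
    {Ω : Set E} {φ : E → ℝ} (hφ : IsTestFun Ω φ) {p : E} (hp : p ∉ Ω) : fderiv ℝ φ p = 0 :=
  fderiv_of_notMem_tsupport ℝ fun h => hp (hφ.2.2 h)

lemma IsTestFun.setIntegral_eq {Ω : Set (ℝ × ℝ)} {φ : ℝ × ℝ → ℝ} (hφ : IsTestFun Ω φ)
    (a b : ℝ × ℝ → ℝ) :
    ∫ p in Ω, (a p * fderiv ℝ φ p (1, 0) + b p * fderiv ℝ φ p (0, 1))
      = ∫ p, (a p * fderiv ℝ φ p (1, 0) + b p * fderiv ℝ φ p (0, 1)) :=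
  setIntegral_eq_integral_of_forall_compl_eq_zero fun p hp => by simp [hφ.fderiv_eq_zero hp]

lemma IsTestFun.continuous_fderiv_apply {E : Type*} [NormedAddCommGroup E] [NormedSpace ℝ E]
    {Ω : Set E} {φ : E → ℝ} (hφ : IsTestFun Ω φ) (v : E) :
    Continuous fun p => fderiv ℝ φ p v :=
  (hφ.1.continuous_fderiv (by simp)).clm_apply continuous_const

/-- The product of two continuous compactly supported functions of `P` and `P' - P`. -/
lemma hasCompactSupport_mul_sub {X Y : ℝ × ℝ → ℝ} (hX : HasCompactSupport X)
    (hY : HasCompactSupport Y) :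
    HasCompactSupport fun z : (ℝ × ℝ) × (ℝ × ℝ) => X z.1 * Y (z.2 - z.1) := by
  refine HasCompactSupport.of_support_subset_isCompact
    ((hX.isCompact.prod hY.isCompact).image
      (f := fun z : (ℝ × ℝ) × (ℝ × ℝ) => (z.1, z.1 + z.2)) (by fun_prop)) ?_
  rintro ⟨P, P'⟩ hz
  rw [Function.mem_support] at hz
  exact ⟨(P, P' - P), ⟨subset_tsupport _ (left_ne_zero_of_mul hz),
    subset_tsupport _ (right_ne_zero_of_mul hz)⟩, by simp⟩

lemma integrable_mul_mul_sub {X Y : ℝ × ℝ → ℝ} (hX : HasCompactSupport X)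
    (hY : HasCompactSupport Y) (hXc : Continuous X) (hYc : Continuous Y)
    {e : ℝ × ℝ → ℝ × ℝ → ℝ} (he : Measurable (Function.uncurry e)) {N : ℝ}
    (heN : ∀ P P', |e P P'| ≤ N) :
    Integrable (fun z : (ℝ × ℝ) × (ℝ × ℝ) => e z.1 z.2 * (X z.1 * Y (z.2 - z.1))) := by
  have h1 : Integrable (fun z : (ℝ × ℝ) × (ℝ × ℝ) => X z.1 * Y (z.2 - z.1)) :=
    Continuous.integrable_of_hasCompactSupport (by fun_prop) (hasCompactSupport_mul_sub hX hY)
  exact h1.bdd_mul (c := N) he.aestronglyMeasurable (Eventually.of_forall fun z => heN _ _)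

/-- Doubling of variables: two families of entropy inequalities, in each of two independent points,
combine into a single inequality for the displacement of the two points. -/
lemma doubling_of_variables {T N : ℝ} {e qa qb : ℝ × ℝ → ℝ × ℝ → ℝ}
    (he : Measurable (Function.uncurry e)) (hqa : Measurable (Function.uncurry qa))
    (hqb : Measurable (Function.uncurry qb)) (heN : ∀ P P', |e P P'| ≤ N)
    (hqaN : ∀ P P', |qa P P'| ≤ N) (hqbN : ∀ P P', |qb P P'| ≤ N)
    (H1 : ∀ P' φ, IsTestFun (Slab1 T) φ → (∀ p, 0 ≤ φ p) →
      0 ≤ ∫ P in Slab1 T, (e P P' * fderiv ℝ φ P (1, 0) + qa P P' * fderiv ℝ φ P (0, 1)))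
    (H2 : ∀ P φ, IsTestFun (Slab1 T) φ → (∀ p, 0 ≤ φ p) →
      0 ≤ ∫ P' in Slab1 T, (e P P' * fderiv ℝ φ P' (1, 0) + qb P P' * fderiv ℝ φ P' (0, 1)))
    {G k : ℝ × ℝ → ℝ} (hG : IsTestFun (Slab1 T) G) (hG0 : ∀ p, 0 ≤ G p)
    (hk : IsTestFun univ k) (hk0 : ∀ p, 0 ≤ k p)
    (hGk : ∀ P ∈ tsupport G, ∀ ζ ∈ tsupport k, P + ζ ∈ Slab1 T) :
    0 ≤ ∫ P, ∫ ζ, ((e P (P + ζ) * fderiv ℝ G P (1, 0) + qa P (P + ζ) * fderiv ℝ G P (0, 1)) * k ζ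
      + (qb P (P + ζ) - qa P (P + ζ)) * G P * fderiv ℝ k ζ (0, 1)) := by
  have hkd : Differentiable ℝ k := hk.1.differentiable (by simp)
  have hGd : Differentiable ℝ G := hG.1.differentiable (by simp)
  have T1 : ∀ P', IsTestFun (Slab1 T) fun P => G P * k (P' - P) := fun P' =>
    ⟨hG.1.mul (hk.1.comp (contDiff_const.sub contDiff_id)), hG.2.1.mul_right,
      (tsupport_mul_subset_left).trans hG.2.2⟩
  have D1 : ∀ P' P v, fderiv ℝ (fun P => G P * k (P' - P)) P v
      = fderiv ℝ G P v * k (P' - P) - G P * fderiv ℝ k (P' - P) v := by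
    intro P' P v
    have h1 : HasFDerivAt (fun P => k (P' - P))
        ((fderiv ℝ k (P' - P)).comp (-(ContinuousLinearMap.id ℝ (ℝ × ℝ)))) P :=
      (hkd (P' - P)).hasFDerivAt.comp P ((hasFDerivAt_id P).const_sub P')
    have h2 : HasFDerivAt (fun P => G P * k (P' - P)) _ P := (hGd P).hasFDerivAt.mul h1
    rw [h2.fderiv]
    simp
    ring
  have D2 : ∀ P P' v, fderiv ℝ (fun P' => G P * k (P' - P)) P' v
      = G P * fderiv ℝ k (P' - P) v := by
    intro P P' v
    have h1 : HasFDerivAt (fun P' => k (P' - P))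
        ((fderiv ℝ k (P' - P)).comp (ContinuousLinearMap.id ℝ (ℝ × ℝ))) P' :=
      (hkd (P' - P)).hasFDerivAt.comp P' ((hasFDerivAt_id P').sub_const P)
    rw [(h1.const_mul (G P)).fderiv]
    simp
  have T2 : ∀ P, IsTestFun (Slab1 T) fun P' => G P * k (P' - P) := by
    intro P
    by_cases hP : G P = 0
    · simp only [hP, zero_mul]
      refine ⟨contDiff_const, HasCompactSupport.zero, ?_⟩
      have : tsupport (fun _ : ℝ × ℝ => (0 : ℝ)) = ∅ := tsupport_eq_empty_iff.2 rfl
      rw [this]; exact empty_subset _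
    · have hcomp : HasCompactSupport fun P' => k (P' - P) :=
        hk.2.1.comp_homeomorph (Homeomorph.subRight P)
      refine ⟨contDiff_const.mul (hk.1.comp (contDiff_id.sub contDiff_const)),
        hcomp.mul_left, ?_⟩
      refine (tsupport_mul_subset_right).trans ?_
      have h1 : tsupport (fun P' => k (P' - P)) ⊆ (fun P' => P' - P) ⁻¹' tsupport k :=
        closure_minimal (fun P' hP' => subset_tsupport _ hP')
          ((isClosed_tsupport k).preimage (by fun_prop))
      intro P' hP'
      have := hGk P (subset_tsupport _ hP) _ (h1 hP')
      simpa using this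
  have hGc := hG.1.continuous
  have hkc := hk.1.continuous
  have hGv := hG.continuous_fderiv_apply
  have hkv := hk.continuous_fderiv_apply
  have hGs := fun v => hG.2.1.fderiv_apply (𝕜 := ℝ) v
  have hks := fun v => hk.2.1.fderiv_apply (𝕜 := ℝ) v
  have i1 : ∀ {q : ℝ × ℝ → ℝ × ℝ → ℝ}, Measurable (Function.uncurry q) → (∀ P P', |q P P'| ≤ N) →
      ∀ v, Integrable (fun z : (ℝ × ℝ) × (ℝ × ℝ) =>
        q z.1 z.2 * (fderiv ℝ G z.1 v * k (z.2 - z.1))) := fun hq hqN v =>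
    integrable_mul_mul_sub (hGs v) hk.2.1 (hGv v) hkc hq hqN
  have i2 : ∀ {q : ℝ × ℝ → ℝ × ℝ → ℝ}, Measurable (Function.uncurry q) → (∀ P P', |q P P'| ≤ N) →
      ∀ v, Integrable (fun z : (ℝ × ℝ) × (ℝ × ℝ) =>
        q z.1 z.2 * (G z.1 * fderiv ℝ k (z.2 - z.1) v)) := fun hq hqN v =>
    integrable_mul_mul_sub hG.2.1 (hks v) hGc (hkv v) hq hqN
  set J1 : ℝ × ℝ → ℝ × ℝ → ℝ := fun P P' =>
    e P P' * (fderiv ℝ G P (1, 0) * k (P' - P) - G P * fderiv ℝ k (P' - P) (1, 0))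
      + qa P P' * (fderiv ℝ G P (0, 1) * k (P' - P) - G P * fderiv ℝ k (P' - P) (0, 1)) with hJ1
  set J2 : ℝ × ℝ → ℝ × ℝ → ℝ := fun P P' =>
    e P P' * (G P * fderiv ℝ k (P' - P) (1, 0)) + qb P P' * (G P * fderiv ℝ k (P' - P) (0, 1))
    with hJ2
  have int1 : Integrable (Function.uncurry J1) (volume.prod volume) := by
    have := ((i1 he heN (1, 0)).sub (i2 he heN (1, 0))).add
      ((i1 hqa hqaN (0, 1)).sub (i2 hqa hqaN (0, 1)))
    refine this.congr (Eventually.of_forall fun z => ?_)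
    simp only [Pi.add_apply, Pi.sub_apply, Function.uncurry, hJ1]
    ring
  have int2 : Integrable (Function.uncurry J2) (volume.prod volume) :=
    (i2 he heN (1, 0)).add (i2 hqb hqbN (0, 1))
  have p1 : 0 ≤ ∫ P, ∫ P', J1 P P' := by
    rw [integral_integral_swap int1]
    refine integral_nonneg fun P' => ?_
    have := H1 P' _ (T1 P') fun P => mul_nonneg (hG0 _) (hk0 _)
    rw [(T1 P').setIntegral_eq (fun P => e P P') (fun P => qa P P')] at this
    simp only [D1] at this
    exact this
  have p2 : 0 ≤ ∫ P, ∫ P', J2 P P' := by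
    refine integral_nonneg fun P => ?_
    have := H2 P _ (T2 P) fun P' => mul_nonneg (hG0 _) (hk0 _)
    rw [(T2 P).setIntegral_eq (fun P' => e P P') (fun P' => qb P P')] at this
    simp only [D2] at this
    exact this
  have key : ∫ P, ∫ P', (J1 P P' + J2 P P') = (∫ P, ∫ P', J1 P P') + ∫ P, ∫ P', J2 P P' :=
    integral_integral_add int1 int2
  have : ∀ P, ∫ ζ, ((e P (P + ζ) * fderiv ℝ G P (1, 0) + qa P (P + ζ) * fderiv ℝ G P (0, 1)) * k ζ
      + (qb P (P + ζ) - qa P (P + ζ)) * G P * fderiv ℝ k ζ (0, 1))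
      = ∫ P', (J1 P P' + J2 P P') := by
    intro P
    rw [← integral_add_left_eq_self (fun P' => J1 P P' + J2 P P') P]
    refine integral_congr_ae (Eventually.of_forall fun ζ => ?_)
    simp only [hJ1, hJ2, add_sub_cancel_left]
    ring
  simp only [this, key]
  exact add_nonneg p1 p2

/-- Translations act continuously on bounded measurable functions, locally in `L¹`. -/
lemma tendsto_integral_translation_sub {r G : ℝ × ℝ → ℝ} {R : ℝ} (hr : Measurable r)
    (hR : ∀ p, |r p| ≤ R) (hG : Continuous G) (hGs : HasCompactSupport G) (hG0 : ∀ p, 0 ≤ G p)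
    (ζ₀ : ℝ × ℝ) :
    Tendsto (fun ζ => ∫ P, |r (P + ζ) - r (P + ζ₀)| * G P) (𝓝 ζ₀) (𝓝 0) := by
  have hR0 : 0 ≤ R := (abs_nonneg _).trans (hR 0)
  obtain ⟨A, hA⟩ : ∃ A, ∀ P, G P ≤ A := by
    obtain ⟨A, hA⟩ := hG.bounded_above_of_compact_support hGs
    exact ⟨A, fun P => (le_abs_self _).trans (hA P)⟩
  have hA0 : 0 ≤ A := (hG0 0).trans (hA 0)
  have hGi : Integrable G := hG.integrable_of_hasCompactSupport hGs
  obtain ⟨ρ, hρ⟩ := hGs.isCompact.isBounded.subset_closedBall (0 : ℝ × ℝ)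
  set S := Metric.closedBall (0 : ℝ × ℝ) (ρ + ‖ζ₀‖ + 1) with hS
  have hSi : Integrable (S.indicator r) := by
    rw [integrable_indicator_iff Metric.isClosed_closedBall.measurableSet]
    exact Measure.integrableOn_of_bounded (M := R)
      (isCompact_closedBall _ _).measure_lt_top.ne hr.aestronglyMeasurable
      (Eventually.of_forall fun p => hR p)
  rw [Metric.tendsto_nhds]
  intro ε hε
  set I := ∫ P, G P with hI
  have hI0 : 0 ≤ I := integral_nonneg hG0
  set ε' := ε / (2 * (2 * A + I + 1)) with hε'
  have hε'0 : 0 < ε' := by positivity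
  obtain ⟨g, hgs, hg, hgc, hgi⟩ := hSi.exists_hasCompactSupport_integral_sub_le hε'0
  have huc := Metric.uniformContinuous_iff.1 (hgs.uniformContinuous_of_continuous hgc)
  obtain ⟨d, hd, hgd⟩ := huc ε' hε'0
  filter_upwards [Metric.ball_mem_nhds ζ₀ (lt_min hd one_pos)] with ζ hζ
  have hζ1 : ‖ζ - ζ₀‖ < 1 := by
    have := (Metric.mem_ball.1 hζ).trans_le (min_le_right _ _); rwa [dist_eq_norm] at this
  have hζd : dist ζ ζ₀ < d := (Metric.mem_ball.1 hζ).trans_le (min_le_left _ _)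
  set u : ℝ × ℝ → ℝ := fun P => ‖S.indicator r P - g P‖ with hu
  have hui : Integrable u := (hSi.sub hgi).norm
  have hpt : ∀ P, |r (P + ζ) - r (P + ζ₀)| * G P
      ≤ A * u (P + ζ) + A * u (P + ζ₀) + ε' * G P := by
    intro P
    by_cases hP : P ∈ tsupport G
    · have hPρ : ‖P‖ ≤ ρ := by simpa using hρ hP
      have m1 : P + ζ ∈ S := by
        rw [hS, mem_closedBall_zero_iff]
        have h1 := norm_add_le P ζ
        have h2 := norm_add_le ζ₀ (ζ - ζ₀)
        rw [add_sub_cancel] at h2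
        linarith
      have m2 : P + ζ₀ ∈ S := by
        rw [hS, mem_closedBall_zero_iff]
        have h1 := norm_add_le P ζ₀
        linarith
      have e1 : u (P + ζ) = |r (P + ζ) - g (P + ζ)| := by simp [hu, m1]
      have e2 : u (P + ζ₀) = |r (P + ζ₀) - g (P + ζ₀)| := by simp [hu, m2]
      have e3 : |g (P + ζ) - g (P + ζ₀)| < ε' := by
        have := @hgd (P + ζ) (P + ζ₀) (by simpa using hζd)
        rwa [Real.dist_eq] at this
      have h1 : |r (P + ζ) - r (P + ζ₀)| ≤ u (P + ζ) + u (P + ζ₀) + ε' := by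
        rw [e1, e2]
        have := abs_add_three (r (P + ζ) - g (P + ζ)) (-(r (P + ζ₀) - g (P + ζ₀)))
          (g (P + ζ) - g (P + ζ₀))
        rw [abs_neg] at this
        have e : r (P + ζ) - g (P + ζ) + -(r (P + ζ₀) - g (P + ζ₀)) + (g (P + ζ) - g (P + ζ₀))
          = r (P + ζ) - r (P + ζ₀) := by ring
        rw [e] at this
        linarith
      calc _ ≤ (u (P + ζ) + u (P + ζ₀) + ε') * G P := by gcongr; exact hG0 P
        _ = u (P + ζ) * G P + u (P + ζ₀) * G P + ε' * G P := by ring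
        _ ≤ u (P + ζ) * A + u (P + ζ₀) * A + ε' * G P := by
          gcongr <;> first | exact norm_nonneg _ | exact hA P
        _ = _ := by ring
    · rw [image_eq_zero_of_notMem_tsupport hP]
      have h1 : 0 ≤ u (P + ζ) := norm_nonneg _
      have h2 : 0 ≤ u (P + ζ₀) := norm_nonneg _
      simp only [mul_zero, add_zero]
      positivity
  have hi1 : Integrable fun P => A * u (P + ζ) := (hui.comp_add_right ζ).const_mul A
  have hi2 : Integrable fun P => A * u (P + ζ₀) := (hui.comp_add_right ζ₀).const_mul A
  have hi12 : Integrable fun P => A * u (P + ζ) + A * u (P + ζ₀) := hi1.add hi2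
  have hnn : 0 ≤ ∫ P, |r (P + ζ) - r (P + ζ₀)| * G P :=
    integral_nonneg fun P => mul_nonneg (abs_nonneg _) (hG0 P)
  have hle : ∫ P, |r (P + ζ) - r (P + ζ₀)| * G P ≤ A * ε' + A * ε' + ε' * I := by
    calc _ ≤ ∫ P, (A * u (P + ζ) + A * u (P + ζ₀) + ε' * G P) := by
          refine integral_mono_of_nonneg
            (Eventually.of_forall fun P => mul_nonneg (abs_nonneg _) (hG0 P))
            (hi12.add (hGi.const_mul ε')) (Eventually.of_forall hpt)
      _ = A * (∫ P, u P) + A * (∫ P, u P) + ε' * I := by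
          rw [integral_add hi12 (hGi.const_mul ε'), integral_add hi1 hi2,
            integral_const_mul, integral_const_mul, integral_const_mul,
            integral_add_right_eq_self u ζ, integral_add_right_eq_self u ζ₀]
      _ ≤ _ := by gcongr
  rw [Real.dist_eq, sub_zero, abs_of_nonneg hnn]
  have : ε' * (2 * (2 * A + I + 1)) = ε := by rw [hε']; field_simp
  nlinarith

lemma integrable_comp_translation_sub_mul {r G : ℝ × ℝ → ℝ} {R : ℝ} (hr : Measurable r)
    (hR : ∀ p, |r p| ≤ R) (hG : Continuous G) (hGs : HasCompactSupport G)
    {D : ℝ → ℝ} (hD : Continuous D) (ζ ζ' : ℝ × ℝ) :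
    Integrable fun P => D (r (P + ζ) - r (P + ζ')) * G P := by
  obtain ⟨N, hN⟩ := (isCompact_Icc (a := -(2 * R)) (b := 2 * R)).exists_bound_of_continuousOn
    hD.continuousOn
  refine (hG.integrable_of_hasCompactSupport hGs).bdd_mul (c := N)
    (Measurable.aestronglyMeasurable (by fun_prop)) (Eventually.of_forall fun P => hN _ ?_)
  have h1 := abs_le.1 (hR (P + ζ))
  have h2 := abs_le.1 (hR (P + ζ'))
  constructor <;> linarith

/-- The weighted modulus of continuity `ζ ↦ ∫ D(r(P + ζ) - r(P)) G(P) dP` is continuous. -/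
lemma continuous_integral_comp_translation_sub {r G : ℝ × ℝ → ℝ} {R : ℝ} (hr : Measurable r)
    (hR : ∀ p, |r p| ≤ R) (hG : Continuous G) (hGs : HasCompactSupport G) (hG0 : ∀ p, 0 ≤ G p)
    {D : ℝ → ℝ} (hD : ContDiff ℝ 1 D) :
    Continuous fun ζ => ∫ P, D (r (P + ζ) - r P) * G P := by
  obtain ⟨L, hL⟩ := (LocallyLipschitz.locallyLipschitzOn (s := Icc (-(2 * R)) (2 * R))
    hD.locallyLipschitz).exists_lipschitzOnWith_of_compact isCompact_Icc
  have hmem : ∀ ζ P, r (P + ζ) - r P ∈ Icc (-(2 * R)) (2 * R) := by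
    intro ζ P
    have h1 := abs_le.1 (hR (P + ζ))
    have h2 := abs_le.1 (hR P)
    constructor <;> linarith
  have hint : ∀ ζ, Integrable fun P => D (r (P + ζ) - r P) * G P := by
    intro ζ
    simpa using integrable_comp_translation_sub_mul hr hR hG hGs hD.continuous ζ 0
  rw [continuous_iff_continuousAt]
  intro ζ₀
  rw [ContinuousAt, tendsto_iff_dist_tendsto_zero]
  have h0 := (tendsto_integral_translation_sub hr hR hG hGs hG0 ζ₀).const_mul (L : ℝ)
  rw [mul_zero] at h0
  refine squeeze_zero (fun _ => dist_nonneg) (fun ζ => ?_) h0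
  rw [Real.dist_eq, ← integral_sub (hint ζ) (hint ζ₀), ← integral_const_mul]
  refine (abs_integral_le_integral_abs).trans ?_
  refine integral_mono ((hint ζ).sub (hint ζ₀)).abs
    ((integrable_comp_translation_sub_mul hr hR hG hGs continuous_abs ζ ζ₀).const_mul _)
    fun P => ?_
  have := hL.dist_le_mul _ (hmem ζ P) _ (hmem ζ₀ P)
  rw [Real.dist_eq, Real.dist_eq, sub_sub_sub_cancel_right] at this
  simp only [← sub_mul, abs_mul, abs_of_nonneg (hG0 P)]
  rw [← mul_assoc]
  exact mul_le_mul_of_nonneg_right this (hG0 P)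

lemma deriv_smoothTransition_eq_zero {x : ℝ} (hx : x ∉ Icc (0 : ℝ) 1) :
    deriv Real.smoothTransition x = 0 := by
  rw [mem_Icc, not_and_or, not_le, not_le] at hx
  rcases hx with hx | hx
  · have : Real.smoothTransition =ᶠ[𝓝 x] fun _ => 0 :=
      (eventually_lt_nhds hx).mono fun y hy => Real.smoothTransition.zero_of_nonpos hy.le
    rw [this.deriv_eq, deriv_const]
  · have : Real.smoothTransition =ᶠ[𝓝 x] fun _ => 1 :=
      (eventually_gt_nhds hx).mono fun y hy => Real.smoothTransition.one_of_one_le hy.le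
    rw [this.deriv_eq, deriv_const]

lemma continuous_deriv_smoothTransition : Continuous (deriv Real.smoothTransition) :=
  (Real.smoothTransition.contDiff (n := 1)).continuous_deriv le_rfl

lemma integral_deriv_smoothTransition : ∫ x, deriv Real.smoothTransition x = 1 := by
  have h1 : ∫ x in (0 : ℝ)..1, deriv Real.smoothTransition x = 1 := by
    rw [intervalIntegral.integral_deriv_eq_sub
      (fun x _ => (Real.smoothTransition.contDiff (n := 1)).differentiable (by simp) x)
      (continuous_deriv_smoothTransition.intervalIntegrable _ _)]
    simp
  rw [intervalIntegral.integral_of_le zero_le_one, ← integral_Icc_eq_integral_Ioc] at h1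
  rw [← h1, setIntegral_eq_integral_of_forall_compl_eq_zero]
  exact fun x hx => deriv_smoothTransition_eq_zero hx

/-- A kernel whose space derivative is a difference of an approximate identity and its
translate by `h`. -/
lemma exists_translation_kernel {h κ : ℝ} (hκ : 0 < κ) (hκh : κ ≤ h) :
    ∃ k χ : ℝ × ℝ → ℝ, IsTestFun univ k ∧ (∀ p, 0 ≤ k p) ∧ (∀ p ∈ tsupport k, |p.1| ≤ κ) ∧
      ∫ p, k p ≤ 2 * h ∧ Continuous χ ∧ HasCompactSupport χ ∧ (∀ p, 0 ≤ χ p) ∧ ∫ p, χ p = 1 ∧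
      (∀ p, χ p ≠ 0 → ‖p‖ ≤ κ) ∧
      ∀ p, fderiv ℝ k p (0, 1) = χ p - χ (p - (0, h)) := by
  have hh : 0 < h := hκ.trans_le hκh
  set S := Real.smoothTransition with hS
  have hSd : Differentiable ℝ S := (Real.smoothTransition.contDiff (n := 1)).differentiable (by simp)
  have hSc : ContDiff ℝ (⊤ : ℕ∞) S := Real.smoothTransition.contDiff
  have hSm : Monotone S := Real.smoothTransition.monotone
  set b : ContDiffBump (0 : ℝ) := ⟨κ / 2, κ, by positivity, by linarith⟩ with hb
  set β : ℝ → ℝ := b.normed volume with hβ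
  have hβc : ContDiff ℝ (⊤ : ℕ∞) β := b.contDiff_normed
  have hβ0 : ∀ t, 0 ≤ β t := fun t => b.nonneg_normed t
  have hβi : ∫ t, β t = 1 := b.integral_normed
  have hβs : tsupport β = Metric.closedBall 0 κ := b.tsupport_normed_eq
  have hβcs : HasCompactSupport β := b.hasCompactSupport_normed
  set φ : ℝ → ℝ := fun x => S (x / κ) - S ((x - h) / κ) with hφ
  set θ : ℝ → ℝ := fun x => κ⁻¹ * deriv S (κ⁻¹ * x) with hθ
  have hθc : Continuous θ := by
    have := continuous_deriv_smoothTransition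
    fun_prop
  have hθ0 : ∀ x, 0 ≤ θ x := fun x => mul_nonneg (by positivity) (hSm.deriv_nonneg)
  have hθs : ∀ x, θ x ≠ 0 → x ∈ Icc 0 κ := by
    intro x hx
    have : κ⁻¹ * x ∈ Icc (0 : ℝ) 1 := by
      by_contra h
      exact hx (by simp [hθ, hS, deriv_smoothTransition_eq_zero h])
    rw [mem_Icc, inv_mul_le_iff₀ hκ, mul_one] at this
    exact ⟨nonneg_of_mul_nonneg_right this.1 (by positivity), this.2⟩
  have hθi : ∫ x, θ x = 1 := by
    rw [hθ, integral_const_mul, Measure.integral_comp_mul_left, integral_deriv_smoothTransition]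
    rw [inv_inv, abs_of_pos hκ, smul_eq_mul, mul_one, inv_mul_cancel₀ hκ.ne']
  have hθcs : HasCompactSupport θ := HasCompactSupport.of_support_subset_isCompact isCompact_Icc hθs
  have hφd : ∀ x, HasDerivAt φ (θ x - θ (x - h)) x := by
    intro x
    have h1 : HasDerivAt (fun x => S (x / κ)) (deriv S (x / κ) * (1 / κ)) x :=
      (hSd _).hasDerivAt.comp x ((hasDerivAt_id x).div_const κ)
    have h2 : HasDerivAt (fun x => S ((x - h) / κ)) (deriv S ((x - h) / κ) * (1 / κ)) x :=
      (hSd _).hasDerivAt.comp x (((hasDerivAt_id x).sub_const h).div_const κ)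
    have h3 : HasDerivAt φ _ x := h1.sub h2
    convert h3 using 1
    simp only [hθ, div_eq_inv_mul]
    ring
  have hφs : ∀ x, φ x ≠ 0 → x ∈ Icc 0 (h + κ) := by
    intro x hx
    by_contra hx'
    rw [mem_Icc, not_and_or, not_le, not_le] at hx'
    refine hx ?_
    rcases hx' with h1 | h1
    · have a1 : x / κ ≤ 0 := div_nonpos_of_nonpos_of_nonneg h1.le hκ.le
      have a2 : (x - h) / κ ≤ 0 := div_nonpos_of_nonpos_of_nonneg (by linarith) hκ.le
      simp [hφ, hS, Real.smoothTransition.zero_of_nonpos a1, Real.smoothTransition.zero_of_nonpos a2]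
    · have a1 : 1 ≤ x / κ := by rw [one_le_div hκ]; linarith
      have a2 : 1 ≤ (x - h) / κ := by rw [one_le_div hκ]; linarith
      simp [hφ, hS, Real.smoothTransition.one_of_one_le a1, Real.smoothTransition.one_of_one_le a2]
  have hφ0 : ∀ x, 0 ≤ φ x := fun x => sub_nonneg.2 (hSm (by gcongr; linarith))
  have hφ1 : ∀ x, φ x ≤ 1 := fun x => by
    have h1 := Real.smoothTransition.le_one (x / κ)
    have h2 := Real.smoothTransition.nonneg ((x - h) / κ)
    simp only [hφ, hS]; linarith
  have hφcs : HasCompactSupport φ := HasCompactSupport.of_support_subset_isCompact isCompact_Icc hφs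
  have hφc : ContDiff ℝ (⊤ : ℕ∞) φ :=
    (hSc.comp (contDiff_id.div_const κ)).sub
      (hSc.comp ((contDiff_id.sub contDiff_const).div_const κ))
  have hφi : ∫ x, φ x ≤ 2 * h := by
    rw [← setIntegral_eq_integral_of_forall_compl_eq_zero (s := Icc 0 (h + κ))
      fun x hx => by_contra fun h' => hx (hφs x h')]
    calc _ ≤ ∫ x in Icc 0 (h + κ), (1 : ℝ) :=
          setIntegral_mono ((hφc.continuous.integrable_of_hasCompactSupport hφcs).integrableOn)
            (integrableOn_const (by simp)) hφ1
      _ = h + κ := by simp [Measure.real]; positivity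
      _ ≤ 2 * h := by linarith
  have hprodcs : ∀ {g : ℝ → ℝ}, HasCompactSupport g →
      HasCompactSupport fun p : ℝ × ℝ => β p.1 * g p.2 := by
    intro g hg
    refine HasCompactSupport.of_support_subset_isCompact (hβcs.isCompact.prod hg.isCompact) ?_
    intro p hp
    rw [Function.mem_support] at hp
    exact ⟨subset_tsupport _ (left_ne_zero_of_mul hp), subset_tsupport _ (right_ne_zero_of_mul hp)⟩
  refine ⟨fun p => β p.1 * φ p.2, fun p => β p.1 * θ p.2,
    ⟨(hβc.comp contDiff_fst).mul (hφc.comp contDiff_snd), hprodcs hφcs, subset_univ _⟩,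
    fun p => mul_nonneg (hβ0 _) (hφ0 _), ?_, ?_, ?_, hprodcs hθcs,
    fun p => mul_nonneg (hβ0 _) (hθ0 _), ?_, ?_, ?_⟩
  · have hsub : tsupport (fun p : ℝ × ℝ => β p.1 * φ p.2) ⊆ {p | |p.1| ≤ κ} := by
      refine closure_minimal ?_ (isClosed_le (by fun_prop) continuous_const)
      intro p hp
      have := subset_tsupport _ (left_ne_zero_of_mul hp)
      rw [hβs, mem_closedBall_zero_iff] at this
      exact this
    exact hsub
  · rw [Measure.volume_eq_prod, integral_prod_mul, hβi, one_mul]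
    exact hφi
  · have := hβc.continuous
    fun_prop
  · rw [Measure.volume_eq_prod, integral_prod_mul, hβi, one_mul, hθi]
  · intro p hp
    have h1 := subset_tsupport _ (left_ne_zero_of_mul hp)
    rw [hβs, mem_closedBall_zero_iff] at h1
    have h2 := hθs _ (right_ne_zero_of_mul hp)
    rw [Prod.norm_def, max_le_iff]
    exact ⟨h1, by rw [Real.norm_eq_abs, abs_of_nonneg h2.1]; exact h2.2⟩
  · intro p
    have h1 : HasFDerivAt (fun p : ℝ × ℝ => β p.1)
        ((ContinuousLinearMap.toSpanSingleton ℝ (deriv β p.1)).comp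
          (ContinuousLinearMap.fst ℝ ℝ ℝ)) p :=
      ((hβc.differentiable (by simp)) p.1).hasDerivAt.hasFDerivAt.comp p hasFDerivAt_fst
    have h2 : HasFDerivAt (fun p : ℝ × ℝ => φ p.2)
        ((ContinuousLinearMap.toSpanSingleton ℝ (θ p.2 - θ (p.2 - h))).comp
          (ContinuousLinearMap.snd ℝ ℝ ℝ)) p :=
      (hφd p.2).hasFDerivAt.comp p hasFDerivAt_snd
    have h3 : HasFDerivAt (fun p : ℝ × ℝ => β p.1 * φ p.2) _ p := h1.mul h2
    rw [h3.fderiv]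
    simp
    ring

/-- Testing with an approximate identity turns a differential inequality for the weighted modulus
of continuity into a pointwise bound. -/
lemma integral_translation_sub_le {r G : ℝ × ℝ → ℝ} {R C₀ τ₀ : ℝ} (hr : Measurable r)
    (hR : ∀ p, |r p| ≤ R) (hG : Continuous G) (hGs : HasCompactSupport G) (hG0 : ∀ p, 0 ≤ G p)
    {D : ℝ → ℝ} (hD : ContDiff ℝ 1 D) (hD0 : D 0 = 0) (hC₀ : 0 ≤ C₀) (hτ₀ : 0 < τ₀)
    (H : ∀ k, IsTestFun univ k → (∀ p, 0 ≤ k p) → (∀ p ∈ tsupport k, |p.1| ≤ τ₀) →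
      0 ≤ C₀ * (∫ p, k p) + ∫ ζ, (∫ P, D (r (P + ζ) - r P) * G P) * fderiv ℝ k ζ (0, 1))
    {h : ℝ} (hh : 0 < h) :
    ∫ P, D (r (P + (0, h)) - r P) * G P ≤ 2 * C₀ * h := by
  set B : ℝ × ℝ → ℝ := fun ζ => ∫ P, D (r (P + ζ) - r P) * G P with hB
  have hBc : Continuous B := continuous_integral_comp_translation_sub hr hR hG hGs hG0 hD
  have hB0 : B 0 = 0 := by simp [hB, hD0]
  change B (0, h) ≤ _
  refine le_of_forall_pos_le_add fun η hη => ?_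
  obtain ⟨d₁, hd₁, h₁⟩ := Metric.continuous_iff.1 hBc 0 (η / 2) (by positivity)
  obtain ⟨d₂, hd₂, h₂⟩ := Metric.continuous_iff.1 hBc (0, h) (η / 2) (by positivity)
  set κ := min (min (d₁ / 2) (d₂ / 2)) (min h τ₀) with hκ
  have hκ0 : 0 < κ := by positivity
  have hκ1 : κ ≤ d₁ / 2 := (min_le_left _ _).trans (min_le_left _ _)
  have hκ2 : κ ≤ d₂ / 2 := (min_le_left _ _).trans (min_le_right _ _)
  have hκh : κ ≤ h := (min_le_right _ _).trans (min_le_left _ _)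
  have hκτ : κ ≤ τ₀ := (min_le_right _ _).trans (min_le_right _ _)
  obtain ⟨k, χ, hk, hk0, hks, hki, hχc, hχs, hχ0, hχi, hχκ, hkχ⟩ :=
    exists_translation_kernel hκ0 hκh
  have hH := H k hk hk0 fun p hp => (hks p hp).trans hκτ
  simp only [hkχ] at hH
  change 0 ≤ _ + ∫ ζ, B ζ * _ at hH
  have hχint : Integrable χ := hχc.integrable_of_hasCompactSupport hχs
  have i1 : Integrable fun ζ => B ζ * χ ζ :=
    (hBc.mul hχc).integrable_of_hasCompactSupport hχs.mul_left
  have i2 : Integrable fun ζ => B (ζ + (0, h)) * χ ζ :=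
    ((hBc.comp (continuous_id.add continuous_const)).mul hχc).integrable_of_hasCompactSupport
      hχs.mul_left
  have i3 : Integrable fun ζ => B ζ * χ (ζ - (0, h)) := by
    have := i2.comp_sub_right (0, h)
    simpa using this
  have e3 : ∫ ζ, B ζ * χ (ζ - (0, h)) = ∫ ζ, B (ζ + (0, h)) * χ ζ := by
    rw [← integral_add_right_eq_self (fun ζ => B ζ * χ (ζ - (0, h))) (0, h)]
    simp
  have e4 : ∫ ζ, B ζ * (χ ζ - χ (ζ - (0, h)))
      = (∫ ζ, B ζ * χ ζ) - ∫ ζ, B (ζ + (0, h)) * χ ζ := by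
    rw [← e3, ← integral_sub i1 i3]
    simp only [mul_sub]
  have b1 : ∫ ζ, B ζ * χ ζ ≤ η / 2 := by
    calc _ ≤ ∫ ζ, η / 2 * χ ζ := by
          refine integral_mono i1 (hχint.const_mul _) fun ζ => ?_
          by_cases hζ : χ ζ = 0
          · simp [hζ]
          refine mul_le_mul_of_nonneg_right ?_ (hχ0 ζ)
          have := h₁ ζ (by rw [dist_zero_right]; linarith [hχκ ζ hζ])
          rw [Real.dist_eq, hB0, sub_zero] at this
          exact (le_abs_self _).trans this.le
      _ = η / 2 := by rw [integral_const_mul, hχi, mul_one]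
  have b2 : B (0, h) - η / 2 ≤ ∫ ζ, B (ζ + (0, h)) * χ ζ := by
    calc _ = ∫ ζ, (B (0, h) - η / 2) * χ ζ := by rw [integral_const_mul, hχi, mul_one]
      _ ≤ _ := by
          refine integral_mono (hχint.const_mul _) i2 fun ζ => ?_
          by_cases hζ : χ ζ = 0
          · simp [hζ]
          refine mul_le_mul_of_nonneg_right ?_ (hχ0 ζ)
          have := h₂ (ζ + (0, h)) (by rw [dist_add_self_left]; linarith [hχκ ζ hζ])
          rw [Real.dist_eq] at this
          linarith [(abs_lt.1 this).1]
  have b3 : C₀ * ∫ p, k p ≤ C₀ * (2 * h) := by gcongr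
  rw [e4] at hH
  linarith

/-- The doubled inequality, with the terms containing derivatives of the cut-off bounded. -/
lemma doubling_cutoff_bound {T N L R : ℝ} {e qa qb : ℝ × ℝ → ℝ × ℝ → ℝ} {r : ℝ × ℝ → ℝ}
    {D : ℝ → ℝ} (hr : Measurable r) (hR : ∀ p, |r p| ≤ R) (hD : Continuous D)
    (he : Measurable (Function.uncurry e)) (hqa : Measurable (Function.uncurry qa))
    (hqb : Measurable (Function.uncurry qb)) (heN : ∀ P P', |e P P'| ≤ N)
    (hqaN : ∀ P P', |qa P P'| ≤ N) (hqbN : ∀ P P', |qb P P'| ≤ N)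
    (he0 : ∀ P P', 0 ≤ e P P') (hqq : ∀ P P', qb P P' - qa P P' = D (r P' - r P))
    (H1 : ∀ P' φ, IsTestFun (Slab1 T) φ → (∀ p, 0 ≤ φ p) →
      0 ≤ ∫ P in Slab1 T, (e P P' * fderiv ℝ φ P (1, 0) + qa P P' * fderiv ℝ φ P (0, 1)))
    (H2 : ∀ P φ, IsTestFun (Slab1 T) φ → (∀ p, 0 ≤ φ p) →
      0 ≤ ∫ P' in Slab1 T, (e P P' * fderiv ℝ φ P' (1, 0) + qb P P' * fderiv ℝ φ P' (0, 1)))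
    {G k : ℝ × ℝ → ℝ} (hG : IsTestFun (Slab1 T) G) (hG0 : ∀ p, 0 ≤ G p)
    (hGt : ∀ p, fderiv ℝ G p (1, 0) ≤ L) (hGx : ∀ p, |fderiv ℝ G p (0, 1)| ≤ L)
    {S : Set (ℝ × ℝ)} (hS : MeasurableSet S) (hSv : volume S ≠ ∞) (hGS : tsupport G ⊆ S)
    (hk : IsTestFun univ k) (hk0 : ∀ p, 0 ≤ k p)
    (hGk : ∀ P ∈ tsupport G, ∀ ζ ∈ tsupport k, P + ζ ∈ Slab1 T) :
    0 ≤ 2 * N * L * volume.real S * (∫ p, k p)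
      + ∫ ζ, (∫ P, D (r (P + ζ) - r P) * G P) * fderiv ℝ k ζ (0, 1) := by
  have hN0 : 0 ≤ N := (abs_nonneg _).trans (heN 0 0)
  have hL0 : 0 ≤ L := (abs_nonneg _).trans (hGx 0)
  have key := doubling_of_variables he hqa hqb heN hqaN hqbN H1 H2 hG hG0 hk hk0 hGk
  set W : (ℝ × ℝ) × (ℝ × ℝ) → ℝ := fun z =>
    (e z.1 (z.1 + z.2) * fderiv ℝ G z.1 (1, 0) + qa z.1 (z.1 + z.2) * fderiv ℝ G z.1 (0, 1)) * k z.2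
    with hW
  set V : (ℝ × ℝ) × (ℝ × ℝ) → ℝ := fun z =>
    D (r (z.1 + z.2) - r z.1) * G z.1 * fderiv ℝ k z.2 (0, 1) with hV
  have hki : Integrable k := hk.1.continuous.integrable_of_hasCompactSupport hk.2.1
  have hGv := fun v => (hG.continuous_fderiv_apply v).integrable_of_hasCompactSupport (μ := volume)
    (hG.2.1.fderiv_apply (𝕜 := ℝ) v)
  have hkv := fun v => (hk.continuous_fderiv_apply v).integrable_of_hasCompactSupport (μ := volume)
    (hk.2.1.fderiv_apply (𝕜 := ℝ) v)
  have hm : Measurable fun z : (ℝ × ℝ) × (ℝ × ℝ) => (z.1, z.1 + z.2) := by fun_prop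
  have iW : Integrable W (volume.prod volume) := by
    have h1 := ((hGv (1, 0)).mul_prod hki).bdd_mul (c := N)
      (he.comp hm).aestronglyMeasurable (Eventually.of_forall fun z => heN _ _)
    have h2 := ((hGv (0, 1)).mul_prod hki).bdd_mul (c := N)
      (hqa.comp hm).aestronglyMeasurable (Eventually.of_forall fun z => hqaN _ _)
    refine (h1.add h2).congr (Eventually.of_forall fun z => ?_)
    simp only [hW, Pi.add_apply, Function.comp, Function.uncurry]
    ring
  have iV : Integrable V (volume.prod volume) := by
    obtain ⟨A, hA⟩ := (isCompact_Icc (a := -(2 * R)) (b := 2 * R)).exists_bound_of_continuousOn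
      hD.continuousOn
    have hGi : Integrable G := hG.1.continuous.integrable_of_hasCompactSupport hG.2.1
    have h1 := (hGi.mul_prod (hkv (0, 1))).bdd_mul (c := A)
      (f := fun z : (ℝ × ℝ) × (ℝ × ℝ) => D (r (z.1 + z.2) - r z.1))
      (Measurable.aestronglyMeasurable (by fun_prop))
      (Eventually.of_forall fun z => hA _ (by
        have h1 := abs_le.1 (hR (z.1 + z.2))
        have h2 := abs_le.1 (hR z.1)
        constructor <;> linarith))
    refine h1.congr (Eventually.of_forall fun z => ?_)
    simp only [hV]
    ring
  have hsplit : ∫ P, ∫ ζ, ((e P (P + ζ) * fderiv ℝ G P (1, 0)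
      + qa P (P + ζ) * fderiv ℝ G P (0, 1)) * k ζ
      + (qb P (P + ζ) - qa P (P + ζ)) * G P * fderiv ℝ k ζ (0, 1))
      = (∫ P, ∫ ζ, W (P, ζ)) + ∫ P, ∫ ζ, V (P, ζ) := by
    simp only [hqq]
    exact integral_integral_add (f := W) (g := V) iW iV
  have hVs : ∫ P, ∫ ζ, V (P, ζ)
      = ∫ ζ, (∫ P, D (r (P + ζ) - r P) * G P) * fderiv ℝ k ζ (0, 1) := by
    rw [integral_integral_swap (f := fun P ζ => V (P, ζ)) iV]
    simp only [hV, integral_mul_const]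
  have hWs : ∫ P, ∫ ζ, W (P, ζ) ≤ 2 * N * L * volume.real S * (∫ p, k p) := by
    have iS : Integrable (S.indicator fun _ => 2 * N * L) := by
      rw [integrable_indicator_iff hS]
      exact integrableOn_const hSv
    calc _ ≤ ∫ P, ∫ ζ, (S.indicator (fun _ => 2 * N * L) P) * k ζ := by
          refine (integral_prod _ iW).symm.trans_le ((integral_mono iW (iS.mul_prod hki)
            fun z => ?_).trans_eq (integral_prod _ (iS.mul_prod hki)))
          refine mul_le_mul_of_nonneg_right ?_ (hk0 _)
          by_cases hz : z.1 ∈ S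
          · rw [indicator_of_mem hz]
            have h1 : e z.1 (z.1 + z.2) * fderiv ℝ G z.1 (1, 0) ≤ N * L :=
              (mul_le_mul_of_nonneg_left (hGt _) (he0 _ _)).trans
                (mul_le_mul_of_nonneg_right ((le_abs_self _).trans (heN _ _)) hL0)
            have h2 : qa z.1 (z.1 + z.2) * fderiv ℝ G z.1 (0, 1) ≤ N * L := by
              refine (le_abs_self _).trans ?_
              rw [abs_mul]
              exact mul_le_mul (hqaN _ _) (hGx _) (abs_nonneg _) hN0
            linarith
          · rw [indicator_of_notMem hz,
              fderiv_of_notMem_tsupport ℝ fun h => hz (hGS h)]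
            simp
      _ = _ := by
          simp only [integral_const_mul, integral_mul_const]
          rw [integral_indicator hS, setIntegral_const, smul_eq_mul]
          ring
  linarith

lemma abs_riemann_le {c M σ : ℝ} (hc : 0 < c) (hσ : σ ^ 2 = 1) {p : ℝ × ℝ} (hp : p ∈ Kset c M) :
    |riemann σ p| ≤ M / c + M := by
  obtain ⟨h1, h2, h3, h4⟩ := mem_Kset hp
  have hp1 : 0 < p.1 := hc.trans_le h1
  have hM : 0 ≤ M := hp1.le.trans h2
  have hσ1 : |σ| = 1 := by rw [← Real.sqrt_sq_eq_abs, hσ, Real.sqrt_one]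
  refine (abs_add_le _ _).trans (add_le_add ?_ ?_)
  · rw [abs_div, abs_of_pos hp1]
    exact div_le_div₀ hM (abs_le.2 ⟨h3, h4⟩) hc h1
  · rwa [abs_mul, hσ1, one_mul, abs_of_pos hp1]

lemma energy_nonneg {p : ℝ × ℝ} (hp : 0 ≤ p.1) : 0 ≤ energy p := by
  unfold energy
  positivity

lemma abs_energy_le {c M : ℝ} (hc : 0 < c) {p : ℝ × ℝ} (hp : p ∈ Kset c M) :
    |energy p| ≤ M ^ 2 / (2 * c) + M ^ 3 / 6 := by
  obtain ⟨h1, h2, h3, h4⟩ := mem_Kset hp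
  have hp1 : 0 < p.1 := hc.trans_le h1
  have hM : 0 ≤ M := hp1.le.trans h2
  rw [abs_of_nonneg (energy_nonneg hp1.le), energy]
  have h5 : p.2 ^ 2 ≤ M ^ 2 := sq_le_sq' h3 h4
  gcongr

lemma abs_energyFlux_le {c M : ℝ} (hc : 0 < c) {p : ℝ × ℝ} (hp : p ∈ Kset c M) :
    |energyFlux p| ≤ M ^ 3 / (2 * c ^ 2) + M ^ 3 / 2 := by
  obtain ⟨h1, h2, h3, h4⟩ := mem_Kset hp
  have hp1 : 0 < p.1 := hc.trans_le h1
  have hM : 0 ≤ M := hp1.le.trans h2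
  have h5 : |p.2| ≤ M := abs_le.2 ⟨h3, h4⟩
  refine (abs_add_le _ _).trans (add_le_add ?_ ?_)
  · rw [abs_div, abs_pow, abs_of_pos (by positivity : 0 < 2 * p.1 ^ 2)]
    gcongr
  · rw [abs_div, abs_mul, abs_of_pos (by positivity : 0 < p.1 ^ 2), abs_two]
    calc |p.2| * p.1 ^ 2 / 2 ≤ M * M ^ 2 / 2 := by gcongr
      _ = M ^ 3 / 2 := by ring

lemma measurable_riemann (σ : ℝ) : Measurable (riemann σ) := by unfold riemann; fun_prop

lemma measurable_energy : Measurable energy := by unfold energy; fun_prop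

lemma measurable_energyFlux : Measurable energyFlux := by unfold energyFlux; fun_prop

/-- The bound on the entropies and fluxes used in the doubling argument. -/
def doublingBound (c M : ℝ) : ℝ :=
  2 * (M / c + M) + 4 * (M / c + M) ^ 2
    + 2 * (M ^ 2 / (2 * c) + M ^ 3 / 6 + (M ^ 3 / (2 * c ^ 2) + M ^ 3 / 2)) / c ^ 2

/-- One-sided increments of a Riemann invariant. -/
lemma IsEntropySolK.integral_posPart_increment_le {c M T σ : ℝ} {U : ℝ × ℝ → ℝ × ℝ}
    (hU : IsEntropySolK c M T U) (hc : 0 < c) (hcM : c < M) (hσ : σ ^ 2 = 1)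
    {G : ℝ × ℝ → ℝ} {L τ₀ : ℝ} (hG : IsTestFun (Slab1 T) G) (hG0 : ∀ p, 0 ≤ G p)
    (hGt : ∀ p, fderiv ℝ G p (1, 0) ≤ L) (hGx : ∀ p, |fderiv ℝ G p (0, 1)| ≤ L)
    {S : Set (ℝ × ℝ)} (hS : MeasurableSet S) (hSv : volume S ≠ ∞) (hGS : tsupport G ⊆ S)
    (hτ₀ : 0 < τ₀) (hGτ : ∀ P ∈ tsupport G, ∀ τ, |τ| ≤ τ₀ → P.1 + τ ∈ Ioo 0 T)
    {ε h : ℝ} (hε : 0 < ε) (hh : 0 < h) :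
    ∫ P, max (riemann σ (U (P + (0, h))) - riemann σ (U P)) 0 * G P
      ≤ 4 * doublingBound c M * L * volume.real S * h / ε + 2 * ε * ∫ P, G P := by
  obtain ⟨f, F, hf, hF, hFf, hfc, hfL, hf0, hF0, hfd, hfabs, hfF⟩ := exists_entropy_profile hε
  set r : ℝ × ℝ → ℝ := fun p => riemann σ (U p) with hr_def
  set R := M / c + M with hR_def
  have hUm := hU.1
  have hUK := hU.2.1
  have hM : 0 < M := hc.trans hcM
  have hR0 : 0 < R := by positivity
  have hr : Measurable r := (measurable_riemann σ).comp hUm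
  have hR : ∀ p, |r p| ≤ R := fun p => abs_riemann_le hc hσ (hUK p)
  have hfm : Measurable f := hf.continuous.measurable
  have hFm : Measurable F := hF.continuous.measurable
  have hdiff : ∀ P P', |r P' - r P| ≤ 2 * R := by
    intro P P'
    have h1 := abs_le.1 (hR P); have h2 := abs_le.1 (hR P')
    rw [abs_le]; constructor <;> linarith
  have hfb : ∀ P P', |f (r P' - r P)| ≤ 2 * R := fun P P' => by
    rw [abs_of_nonneg (hf0 _)]
    exact (hfabs _).trans (hdiff _ _)
  have hrfb : ∀ P P' Q, |r Q * f (r P' - r P)| ≤ 2 * R ^ 2 := fun P P' Q => by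
    rw [abs_mul]
    calc _ ≤ R * (2 * R) := mul_le_mul (hR Q) (hfb P P') (abs_nonneg _) hR0.le
      _ = _ := by ring
  have hFb : ∀ P P', |F (r P' - r P)| ≤ 2 * R ^ 2 := fun P P' => by
    rw [abs_of_nonneg (hF0 _)]
    have h1 := hfF (r P' - r P)
    have h2 : 0 ≤ ε * f (r P' - r P) := mul_nonneg hε.le (hf0 _)
    have h3 := (abs_le.1 (hrfb P P' P')).2
    have h4 := (abs_le.1 (hrfb P P' P)).1
    linarith [sub_mul (r P') (r P) (f (r P' - r P))]
  set E := M ^ 2 / (2 * c) + M ^ 3 / 6 with hE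
  set E' := M ^ 3 / (2 * c ^ 2) + M ^ 3 / 2 with hE'
  have hE0 : 0 ≤ E := by positivity
  have hE'0 : 0 ≤ E' := by positivity
  have hN : doublingBound c M = 2 * R + 4 * R ^ 2 + (2 * (E / c ^ 2) + 2 * (E' / c ^ 2)) := by
    rw [doublingBound]; ring
  have hEb : ∀ p, |energy (U p) / c ^ 2| ≤ E / c ^ 2 := fun p => by
    rw [abs_div, abs_of_pos (by positivity : 0 < c ^ 2)]
    exact div_le_div_of_nonneg_right (abs_energy_le hc (hUK p)) (by positivity)
  have hE'b : ∀ p, |energyFlux (U p) / c ^ 2| ≤ E' / c ^ 2 := fun p => by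
    rw [abs_div, abs_of_pos (by positivity : 0 < c ^ 2)]
    exact div_le_div_of_nonneg_right (abs_energyFlux_le hc (hUK p)) (by positivity)
  have hEc : 0 ≤ E / c ^ 2 := by positivity
  have hE'c : 0 ≤ E' / c ^ 2 := by positivity
  have hen : ∀ p, 0 ≤ energy (U p) / c ^ 2 := fun p =>
    div_nonneg (energy_nonneg (hc.le.trans (mem_Kset (hUK p)).1)) (by positivity)
  set e : ℝ × ℝ → ℝ × ℝ → ℝ := fun P P' =>
    f (r P' - r P) + energy (U P) / c ^ 2 + energy (U P') / c ^ 2 with he_def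
  set qa : ℝ × ℝ → ℝ × ℝ → ℝ := fun P P' =>
    r P * f (r P' - r P) + F (r P' - r P) + energyFlux (U P) / c ^ 2 + energyFlux (U P') / c ^ 2
    with hqa_def
  set qb : ℝ × ℝ → ℝ × ℝ → ℝ := fun P P' =>
    r P' * f (r P' - r P) - F (r P' - r P) + energyFlux (U P) / c ^ 2 + energyFlux (U P') / c ^ 2
    with hqb_def
  set D : ℝ → ℝ := fun d => d * f d - 2 * F d with hD_def
  have hDc : ContDiff ℝ 2 D := (contDiff_id.mul hf).sub (contDiff_const.mul hF)
  have hD0 : D 0 = 0 := by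
    have h1 := hfF 0
    have h2 := mul_nonneg hε.le (hf0 0)
    have h3 := hF0 0
    simp only [hD_def]
    linarith
  have mE := measurable_energy
  have mF := measurable_energyFlux
  have he : Measurable (Function.uncurry e) := by
    simp only [he_def, Function.uncurry_def]; fun_prop
  have hqa : Measurable (Function.uncurry qa) := by
    simp only [hqa_def, Function.uncurry_def]; fun_prop
  have hqb : Measurable (Function.uncurry qb) := by
    simp only [hqb_def, Function.uncurry_def]; fun_prop
  have heN : ∀ P P', |e P P'| ≤ doublingBound c M := fun P P' => by
    rw [hN, abs_le]
    have h1 := abs_le.1 (hfb P P')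
    have h2 := abs_le.1 (hEb P)
    have h3 := abs_le.1 (hEb P')
    have h4 := sq_nonneg R
    simp only [he_def]
    constructor <;> linarith
  have hqaN : ∀ P P', |qa P P'| ≤ doublingBound c M := fun P P' => by
    rw [hN, abs_le]
    have h1 := abs_le.1 (hrfb P P' P)
    have h2 := abs_le.1 (hE'b P)
    have h3 := abs_le.1 (hE'b P')
    have h4 := abs_le.1 (hFb P P')
    simp only [hqa_def]
    constructor <;> linarith
  have hqbN : ∀ P P', |qb P P'| ≤ doublingBound c M := fun P P' => by
    rw [hN, abs_le]
    have h1 := abs_le.1 (hrfb P P' P')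
    have h2 := abs_le.1 (hE'b P)
    have h3 := abs_le.1 (hE'b P')
    have h4 := abs_le.1 (hFb P P')
    simp only [hqb_def]
    constructor <;> linarith
  have he0 : ∀ P P', 0 ≤ e P P' := fun P P' => add_nonneg (add_nonneg (hf0 _) (hen P)) (hen P')
  have hfD : ∀ x, HasDerivAt f (deriv f x) x := fun x =>
    (hf.differentiable (by simp) x).hasDerivAt
  have hFD : ∀ x, HasDerivAt F (f x) x := fun x => by
    rw [← hFf]; exact (hF.differentiable (by simp) x).hasDerivAt
  have H1 : ∀ P' φ, IsTestFun (Slab1 T) φ → (∀ p, 0 ≤ φ p) →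
      0 ≤ ∫ P in Slab1 T, (e P P' * fderiv ℝ φ P (1, 0) + qa P P' * fderiv ℝ φ P (0, 1)) := by
    intro P' φ hφ hφ0
    set b := r P' with hb
    have hsub : ContDiff ℝ 2 fun s : ℝ => b - s := contDiff_const.sub contDiff_id
    have hA' : ∀ s, HasDerivAt (fun s => f (b - s)) (-deriv f (b - s)) s := fun s =>
      (hfD (b - s)).comp_const_sub b s
    have hF' : ∀ s, HasDerivAt (fun s => F (b - s)) (-f (b - s)) s := fun s =>
      (hFD (b - s)).comp_const_sub b s
    refine hU.riemann_entropy_ineq hc hcM hσ (A := fun s => f (b - s))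
      (q := fun s => s * f (b - s) + F (b - s)) (hf.comp hsub)
      ((contDiff_id.mul (hf.comp hsub)).add (hF.comp hsub)) ?_ ?_ ?_
      (energy (U P') / c ^ 2) (energyFlux (U P') / c ^ 2) hφ hφ0
    · refine ⟨convex_univ, fun x _ y _ u v hu hv huv => ?_⟩
      have := hfc.2 (mem_univ (b - x)) (mem_univ (b - y)) hu hv huv
      have e1 : u • (b - x) + v • (b - y) = b - (u • x + v • y) := by
        simp only [smul_eq_mul]; linear_combination b * huv
      rwa [e1] at this
    · intro x y
      refine (hfL _ _).trans_eq ?_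
      rw [sub_sub_sub_cancel_left, abs_sub_comm]
    · intro s
      have h1 : HasDerivAt (fun s => s * f (b - s) + F (b - s)) _ s :=
        ((hasDerivAt_id s).mul (hA' s)).add (hF' s)
      rw [h1.deriv, (hA' s).deriv]
      simp
  have H2 : ∀ P φ, IsTestFun (Slab1 T) φ → (∀ p, 0 ≤ φ p) →
      0 ≤ ∫ P' in Slab1 T, (e P P' * fderiv ℝ φ P' (1, 0) + qb P P' * fderiv ℝ φ P' (0, 1)) := by
    intro P φ hφ hφ0
    set a := r P with ha
    have hsub : ContDiff ℝ 2 fun s : ℝ => s - a := contDiff_id.sub contDiff_const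
    have hA' : ∀ s, HasDerivAt (fun s => f (s - a)) (deriv f (s - a)) s := fun s =>
      (hfD (s - a)).comp_sub_const s a
    have hF' : ∀ s, HasDerivAt (fun s => F (s - a)) (f (s - a)) s := fun s =>
      (hFD (s - a)).comp_sub_const s a
    have := hU.riemann_entropy_ineq hc hcM hσ (A := fun s => f (s - a))
      (q := fun s => s * f (s - a) - F (s - a)) (hf.comp hsub)
      ((contDiff_id.mul (hf.comp hsub)).sub (hF.comp hsub)) ?_ ?_ ?_
      (energy (U P) / c ^ 2) (energyFlux (U P) / c ^ 2) hφ hφ0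
    · refine this.trans_eq (integral_congr_ae (Eventually.of_forall fun P' => ?_))
      simp only [he_def, hqb_def, hr_def, ha]
      ring
    · refine ⟨convex_univ, fun x _ y _ u v hu hv huv => ?_⟩
      have := hfc.2 (mem_univ (x - a)) (mem_univ (y - a)) hu hv huv
      have e1 : u • (x - a) + v • (y - a) = (u • x + v • y) - a := by
        simp only [smul_eq_mul]; linear_combination -a * huv
      rwa [e1] at this
    · intro x y
      refine (hfL _ _).trans_eq ?_
      rw [sub_sub_sub_cancel_right]
    · intro s
      have h1 : HasDerivAt (fun s => s * f (s - a) - F (s - a)) _ s :=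
        ((hasDerivAt_id s).mul (hA' s)).sub (hF' s)
      rw [h1.deriv, (hA' s).deriv]
      simp
  have hqq : ∀ P P', qb P P' - qa P P' = D (r P' - r P) := fun P P' => by
    simp only [hqa_def, hqb_def, hD_def]; ring
  have hN0 : 0 ≤ doublingBound c M := (abs_nonneg _).trans (heN 0 0)
  have hL0 : 0 ≤ L := (abs_nonneg _).trans (hGx 0)
  have hGc := hG.1.continuous
  have hGi : Integrable G := hGc.integrable_of_hasCompactSupport hG.2.1
  have key : ∫ P, D (r (P + (0, h)) - r P) * G P
      ≤ 2 * (2 * doublingBound c M * L * volume.real S) * h := by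
    refine integral_translation_sub_le hr hR hGc hG.2.1 hG0 (hDc.of_le (by norm_num)) hD0
      (by positivity) hτ₀ (fun k hk hk0 hks => ?_) hh
    refine doubling_cutoff_bound hr hR hDc.continuous he hqa hqb heN hqaN hqbN he0 hqq H1 H2 hG hG0
      hGt hGx hS hSv hGS hk hk0 fun P hP ζ hζ => ?_
    exact hGτ P hP _ (hks ζ hζ)
  have iD := integrable_comp_translation_sub_mul hr hR hGc hG.2.1 hDc.continuous (0, h) 0
  have iP := integrable_comp_translation_sub_mul hr hR hGc hG.2.1
    (D := fun d => max d 0) (by fun_prop) (0, h) 0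
  simp only [add_zero] at iD iP
  calc ∫ P, max (r (P + (0, h)) - r P) 0 * G P
      ≤ ∫ P, (ε⁻¹ * (D (r (P + (0, h)) - r P) * G P) + 2 * ε * G P) := by
        refine integral_mono iP ((iD.const_mul _).add (hGi.const_mul _)) fun P => ?_
        set d := r (P + (0, h)) - r P
        have h1 : max d 0 ≤ f d + 2 * ε := by
          refine max_le ?_ ?_
          · linarith [hfd d]
          · linarith [hf0 d]
        have h2 : f d ≤ ε⁻¹ * D d := by
          rw [le_inv_mul_iff₀ hε]; exact hfF d
        calc max d 0 * G P ≤ (ε⁻¹ * D d + 2 * ε) * G P :=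
              mul_le_mul_of_nonneg_right (by linarith) (hG0 P)
          _ = _ := by ring
    _ = ε⁻¹ * (∫ P, D (r (P + (0, h)) - r P) * G P) + 2 * ε * ∫ P, G P := by
        rw [integral_add (iD.const_mul _) (hGi.const_mul _), integral_const_mul, integral_const_mul]
    _ ≤ ε⁻¹ * (2 * (2 * doublingBound c M * L * volume.real S) * h) + 2 * ε * ∫ P, G P := by
        gcongr
    _ = _ := by ring

lemma fderiv_mul_fst_snd {a b : ℝ → ℝ} {a' b' : ℝ} {p : ℝ × ℝ} (ha : HasDerivAt a a' p.1)
    (hb : HasDerivAt b b' p.2) :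
    fderiv ℝ (fun p : ℝ × ℝ => a p.1 * b p.2) p (1, 0) = a' * b p.2 ∧
      fderiv ℝ (fun p : ℝ × ℝ => a p.1 * b p.2) p (0, 1) = a p.1 * b' := by
  have h1 : HasFDerivAt (fun p : ℝ × ℝ => a p.1)
      ((ContinuousLinearMap.toSpanSingleton ℝ a').comp (ContinuousLinearMap.fst ℝ ℝ ℝ)) p :=
    ha.hasFDerivAt.comp p hasFDerivAt_fst
  have h2 : HasFDerivAt (fun p : ℝ × ℝ => b p.2)
      ((ContinuousLinearMap.toSpanSingleton ℝ b').comp (ContinuousLinearMap.snd ℝ ℝ ℝ)) p :=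
    hb.hasFDerivAt.comp p hasFDerivAt_snd
  have h3 : HasFDerivAt (fun p : ℝ × ℝ => a p.1 * b p.2) _ p := h1.mul h2
  rw [h3.fderiv]
  constructor
  · simp
    ring
  · simp

/-- Cut-off functions on the slab, whose time derivative is bounded from above independently of
the distance `κ` to the final time. -/
lemma exists_slab_cutoff {δ T : ℝ} (hδ : 0 < δ) {K' : Set ℝ} (hK' : IsCompact K') :
    ∃ (L : ℝ) (S : Set (ℝ × ℝ)), MeasurableSet S ∧ volume S ≠ ∞ ∧ ∀ κ, 0 < κ →
      ∃ (G : ℝ × ℝ → ℝ) (τ₀ : ℝ), IsTestFun (Slab1 T) G ∧ (∀ p, 0 ≤ G p) ∧ (∀ p, G p ≤ 1) ∧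
        (∀ p, fderiv ℝ G p (1, 0) ≤ L) ∧ (∀ p, |fderiv ℝ G p (0, 1)| ≤ L) ∧ tsupport G ⊆ S ∧
        0 < τ₀ ∧ (∀ P ∈ tsupport G, ∀ τ, |τ| ≤ τ₀ → P.1 + τ ∈ Ioo 0 T) ∧
        ∀ t ∈ Icc δ (T - κ), ∀ x ∈ K', G (t, x) = 1 := by
  set s := Real.smoothTransition with hs
  have hsd : Differentiable ℝ s := (Real.smoothTransition.contDiff (n := 1)).differentiable (by simp)
  have hsc : ContDiff ℝ (⊤ : ℕ∞) s := Real.smoothTransition.contDiff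
  obtain ⟨B, hB⟩ := continuous_deriv_smoothTransition.bounded_above_of_compact_support
    (HasCompactSupport.intro isCompact_Icc fun x hx => deriv_smoothTransition_eq_zero hx)
  obtain ⟨ρ, hρ⟩ := hK'.isBounded.subset_closedBall (0 : ℝ)
  set ψ : ContDiffBump (0 : ℝ) := ⟨max ρ 1, max ρ 1 + 1, by positivity, by linarith⟩ with hψ
  have hψc : ContDiff ℝ (⊤ : ℕ∞) ψ := ψ.contDiff
  obtain ⟨B', hB'⟩ := (hψc.continuous_deriv (by simp)).bounded_above_of_compact_support
    ψ.hasCompactSupport.deriv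
  have hψK : ∀ x ∈ K', ψ x = 1 := fun x hx =>
    ψ.one_of_mem_closedBall (Metric.closedBall_subset_closedBall (le_max_left _ _) (hρ hx))
  have hψs : tsupport ψ = Metric.closedBall 0 (max ρ 1 + 1) := ψ.tsupport_eq
  have hB0 : 0 ≤ B := (norm_nonneg _).trans (hB 0)
  have hB'0 : 0 ≤ B' := (norm_nonneg _).trans (hB' 0)
  refine ⟨B * (2 / δ) + B', Icc 0 T ×ˢ Metric.closedBall 0 (max ρ 1 + 1),
    measurableSet_Icc.prod measurableSet_closedBall,
    (isCompact_Icc.prod (isCompact_closedBall _ _)).measure_lt_top.ne, fun κ hκ => ?_⟩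
  set α₁ : ℝ → ℝ := fun t => s (2 / δ * t - 1) with hα₁
  set α₂ : ℝ → ℝ := fun t => s (2 / κ * (T - t) - 1) with hα₂
  have hα₁d : ∀ t, HasDerivAt α₁ (deriv s (2 / δ * t - 1) * (2 / δ)) t := fun t =>
    (hsd _).hasDerivAt.comp t (by
      simpa using ((hasDerivAt_id t).const_mul (2 / δ)).sub_const 1)
  have hα₂d : ∀ t, HasDerivAt α₂ (deriv s (2 / κ * (T - t) - 1) * (2 / κ * (-1))) t := fun t =>
    (hsd _).hasDerivAt.comp t
      ((((hasDerivAt_id t).const_sub T).const_mul (2 / κ)).sub_const 1)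
  have hα₁c : ContDiff ℝ (⊤ : ℕ∞) α₁ :=
    hsc.comp ((contDiff_const.mul contDiff_id).sub contDiff_const)
  have hα₂c : ContDiff ℝ (⊤ : ℕ∞) α₂ :=
    hsc.comp ((contDiff_const.mul (contDiff_const.sub contDiff_id)).sub contDiff_const)
  have hs0 : ∀ x, 0 ≤ s x := Real.smoothTransition.nonneg
  have hs1 : ∀ x, s x ≤ 1 := Real.smoothTransition.le_one
  set α : ℝ → ℝ := fun t => α₁ t * α₂ t with hα
  have hα0 : ∀ t, 0 ≤ α t := fun t => mul_nonneg (hs0 _) (hs0 _)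
  have hα1 : ∀ t, α t ≤ 1 := fun t => mul_le_one₀ (hs1 _) (hs0 _) (hs1 _)
  have hαd : ∀ t, HasDerivAt α (deriv s (2 / δ * t - 1) * (2 / δ) * α₂ t
      + α₁ t * (deriv s (2 / κ * (T - t) - 1) * (2 / κ * (-1)))) t := fun t =>
    (hα₁d t).mul (hα₂d t)
  have hα' : ∀ t, deriv s (2 / δ * t - 1) * (2 / δ) * α₂ t
      + α₁ t * (deriv s (2 / κ * (T - t) - 1) * (2 / κ * (-1))) ≤ B * (2 / δ) := by
    intro t
    have h1 : deriv s (2 / δ * t - 1) * (2 / δ) * α₂ t ≤ B * (2 / δ) * 1 := by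
      have := (le_abs_self _).trans (hB (2 / δ * t - 1))
      gcongr
      · exact hs0 _
      · exact hs1 _
    have h2 : 0 ≤ α₁ t * (deriv s (2 / κ * (T - t) - 1) * (2 / κ)) :=
      mul_nonneg (hs0 _) (mul_nonneg (Real.smoothTransition.monotone.deriv_nonneg) (by positivity))
    linarith
  have hαs : ∀ t, α t ≠ 0 → t ∈ Icc (δ / 2) (T - κ / 2) := by
    intro t ht
    have h1 : 0 < 2 / δ * t - 1 := by
      by_contra! h
      exact left_ne_zero_of_mul ht (Real.smoothTransition.zero_of_nonpos h)
    have h2 : 0 < 2 / κ * (T - t) - 1 := by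
      by_contra! h
      exact right_ne_zero_of_mul ht (Real.smoothTransition.zero_of_nonpos h)
    have h3 : 2 / δ * t - 1 = 2 / δ * (t - δ / 2) := by field_simp
    have h4 : 2 / κ * (T - t) - 1 = 2 / κ * (T - κ / 2 - t) := by field_simp; ring
    rw [h3] at h1
    rw [h4] at h2
    have h5 := pos_of_mul_pos_right h1 (by positivity)
    have h6 := pos_of_mul_pos_right h2 (by positivity)
    constructor <;> linarith
  have hts : tsupport (fun p : ℝ × ℝ => α p.1 * ψ p.2)
      ⊆ Icc (δ / 2) (T - κ / 2) ×ˢ Metric.closedBall 0 (max ρ 1 + 1) := by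
    refine closure_minimal (fun p hp => ⟨hαs _ (left_ne_zero_of_mul hp), ?_⟩)
      (isClosed_Icc.prod Metric.isClosed_closedBall)
    rw [← hψs]
    exact subset_tsupport _ (right_ne_zero_of_mul hp)
  refine ⟨fun p => α p.1 * ψ p.2, min (δ / 4) (κ / 4),
    ⟨((hα₁c.mul hα₂c).comp contDiff_fst).mul (hψc.comp contDiff_snd), ?_, ?_⟩,
    fun p => mul_nonneg (hα0 _) ψ.nonneg, fun p => mul_le_one₀ (hα1 _) ψ.nonneg ψ.le_one, ?_, ?_,
    ?_, by positivity, ?_, ?_⟩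
  · exact HasCompactSupport.of_support_subset_isCompact
      (isCompact_Icc.prod (isCompact_closedBall _ _)) ((subset_tsupport _).trans hts)
  · intro p hp
    have := (hts hp).1
    exact ⟨by linarith [this.1], by linarith [this.2]⟩
  · intro p
    rw [(fderiv_mul_fst_snd (hαd p.1) (hψc.differentiable (by simp) p.2).hasDerivAt).1]
    have h1 : B * (2 / δ) * ψ p.2 ≤ B * (2 / δ) * 1 := by
      have := ψ.le_one (x := p.2)
      gcongr
    have h2 := mul_le_mul_of_nonneg_right (hα' p.1) (ψ.nonneg (x := p.2))
    linarith
  · intro p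
    rw [(fderiv_mul_fst_snd (hαd p.1) (hψc.differentiable (by simp) p.2).hasDerivAt).2,
      abs_mul, abs_of_nonneg (hα0 _)]
    have h1 : α p.1 * |deriv ψ p.2| ≤ 1 * B' :=
      mul_le_mul (hα1 _) (hB' _) (abs_nonneg _) zero_le_one
    have h2 : 0 ≤ B * (2 / δ) := by positivity
    linarith
  · refine hts.trans (prod_mono (fun t ht => ?_) le_rfl)
    exact ⟨by linarith [ht.1], by linarith [ht.2]⟩
  · intro P hP τ hτ
    have h1 := (hts hP).1
    have h2 := abs_le.1 hτ
    have h3 := min_le_left (δ / 4) (κ / 4)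
    have h4 := min_le_right (δ / 4) (κ / 4)
    exact ⟨by linarith [h1.1, h2.1], by linarith [h1.2, h2.2]⟩
  · intro t ht x hx
    have h1 : 1 ≤ 2 / δ * t - 1 := by
      have : 2 / δ * δ ≤ 2 / δ * t := by have := ht.1; gcongr
      rw [div_mul_cancel₀ _ hδ.ne'] at this
      linarith
    have h2 : 1 ≤ 2 / κ * (T - t) - 1 := by
      have : 2 / κ * κ ≤ 2 / κ * (T - t) := by have := ht.2; gcongr; linarith
      rw [div_mul_cancel₀ _ hκ.ne'] at this
      linarith
    simp only [hα, hα₁, hα₂, hs]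
    rw [Real.smoothTransition.one_of_one_le h1, Real.smoothTransition.one_of_one_le h2, hψK x hx]
    norm_num

/-- Space increments have small mean. -/
lemma neg_le_integral_increment {r G : ℝ × ℝ → ℝ} {R L h : ℝ} (hr : Measurable r)
    (hR : ∀ p, |r p| ≤ R) {Ω : Set (ℝ × ℝ)} (hG : IsTestFun Ω G)
    (hGx : ∀ p, |fderiv ℝ G p (0, 1)| ≤ L)
    {S : Set (ℝ × ℝ)} (hS : MeasurableSet S) (hSv : volume S ≠ ∞) (hGS : tsupport G ⊆ S)
    (hh : 0 < h) :
    -(2 * R * L * volume.real S * h) ≤ ∫ P, (r (P + (0, h)) - r P) * G P := by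
  have hR0 : 0 ≤ R := (abs_nonneg _).trans (hR 0)
  have hL0 : 0 ≤ L := (abs_nonneg _).trans (hGx 0)
  have hGc := hG.1.continuous
  have hGi : Integrable G := hGc.integrable_of_hasCompactSupport hG.2.1
  have hLip : ∀ P : ℝ × ℝ, |G (P + (0, h)) - G P| ≤ L * h := by
    intro P
    have hd : ∀ x : ℝ, HasDerivAt (fun x => G (P + (0, x))) (fderiv ℝ G (P + (0, x)) (0, 1)) x := by
      intro x
      have h1 : HasDerivAt (fun x : ℝ => P + (0, x)) ((0, 1) : ℝ × ℝ) x :=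
        ((hasDerivAt_const x (0 : ℝ)).prodMk (hasDerivAt_id x)).const_add P
      exact ((hG.1.differentiable (by simp)) _).hasFDerivAt.comp_hasDerivAt x h1
    have := (convex_univ (𝕜 := ℝ) (E := ℝ)).norm_image_sub_le_of_norm_hasDerivWithin_le
      (fun x _ => (hd x).hasDerivWithinAt) (fun x _ => hGx _) (mem_univ 0) (mem_univ h)
    have e0 : P + ((0 : ℝ), (0 : ℝ)) = P := add_zero P
    simpa [abs_of_pos hh, e0] using this
  have i1 : Integrable fun P => r (P + (0, h)) * G P :=
    hGi.bdd_mul (c := R) (Measurable.aestronglyMeasurable (by fun_prop))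
      (Eventually.of_forall fun P => hR _)
  have i2 : Integrable fun P => r P * G P :=
    hGi.bdd_mul (c := R) hr.aestronglyMeasurable (Eventually.of_forall fun P => hR _)
  have i3 : Integrable fun P => r P * G (P - (0, h)) := by
    simpa using i1.comp_sub_right (0, h)
  have e1 : ∫ P, r (P + (0, h)) * G P = ∫ P, r P * G (P - (0, h)) := by
    rw [← integral_add_right_eq_self (fun P => r P * G (P - (0, h))) (0, h)]
    simp
  have e2 : ∫ P, (r (P + (0, h)) - r P) * G P = ∫ P, r P * (G (P - (0, h)) - G P) := by
    simp only [sub_mul, mul_sub]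
    rw [integral_sub i1 i2, integral_sub i3 i2, e1]
  set I : ℝ × ℝ → ℝ := S.indicator fun _ => R * (L * h) with hI
  have hI0 : ∀ P, 0 ≤ I P := fun P => indicator_nonneg (fun _ _ => by positivity) P
  have hIi : Integrable I := by
    rw [integrable_indicator_iff hS]; exact integrableOn_const hSv
  have hIe : ∫ P, I P = R * L * volume.real S * h := by
    rw [hI, integral_indicator hS, setIntegral_const, smul_eq_mul]; ring
  have hb : ∀ P, |r P * (G (P - (0, h)) - G P)| ≤ I P + I (P - (0, h)) := by
    intro P
    have h1 : |G (P - (0, h)) - G P| ≤ L * h := by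
      have := hLip (P - (0, h))
      rwa [sub_add_cancel, abs_sub_comm] at this
    have h2 : |r P * (G (P - (0, h)) - G P)| ≤ R * (L * h) := by
      rw [abs_mul]
      exact mul_le_mul (hR _) h1 (abs_nonneg _) hR0
    by_cases hP : P ∈ S
    · have : I P = R * (L * h) := indicator_of_mem hP _
      linarith [hI0 (P - (0, h))]
    by_cases hP' : P - (0, h) ∈ S
    · have : I (P - (0, h)) = R * (L * h) := indicator_of_mem hP' _
      linarith [hI0 P]
    have h3 : G P = 0 := image_eq_zero_of_notMem_tsupport fun h => hP (hGS h)
    have h4 : G (P - (0, h)) = 0 := image_eq_zero_of_notMem_tsupport fun h => hP' (hGS h)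
    rw [h3, h4]
    simpa using add_nonneg (hI0 P) (hI0 (P - (0, h)))
  have i4 : Integrable fun P => r P * (G (P - (0, h)) - G P) := by
    simp only [mul_sub]; exact i3.sub i2
  have hle : |∫ P, r P * (G (P - (0, h)) - G P)| ≤ 2 * R * L * volume.real S * h := by
    calc _ ≤ ∫ P, |r P * (G (P - (0, h)) - G P)| := abs_integral_le_integral_abs
      _ ≤ ∫ P, (I P + I (P - (0, h))) :=
          integral_mono i4.abs (hIi.add (hIi.comp_sub_right (0, h))) hb
      _ = _ := by
          rw [integral_add hIi (hIi.comp_sub_right (0, h)), integral_sub_right_eq_self I, hIe]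
          ring
  rw [e2]
  exact (abs_le.1 hle).1

lemma IsEntropySolK.integral_abs_increment_le {c M T σ : ℝ} {U : ℝ × ℝ → ℝ × ℝ}
    (hU : IsEntropySolK c M T U) (hc : 0 < c) (hcM : c < M) (hσ : σ ^ 2 = 1)
    {G : ℝ × ℝ → ℝ} {L τ₀ : ℝ} (hG : IsTestFun (Slab1 T) G) (hG0 : ∀ p, 0 ≤ G p)
    (hG1 : ∀ p, G p ≤ 1)
    (hGt : ∀ p, fderiv ℝ G p (1, 0) ≤ L) (hGx : ∀ p, |fderiv ℝ G p (0, 1)| ≤ L)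
    {S : Set (ℝ × ℝ)} (hS : MeasurableSet S) (hSv : volume S ≠ ∞) (hGS : tsupport G ⊆ S)
    (hτ₀ : 0 < τ₀) (hGτ : ∀ P ∈ tsupport G, ∀ τ, |τ| ≤ τ₀ → P.1 + τ ∈ Ioo 0 T)
    {h : ℝ} (hh : 0 < h) (hh1 : h ≤ 1) :
    ∫ P, |riemann σ (U (P + (0, h))) - riemann σ (U P)| * G P
      ≤ (8 * doublingBound c M * L + 4 + 2 * (M / c + M) * L) * volume.real S * √h := by
  set r : ℝ × ℝ → ℝ := fun p => riemann σ (U p) with hr_def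
  have hr : Measurable r := (measurable_riemann σ).comp hU.1
  have hR : ∀ p, |r p| ≤ M / c + M := fun p => abs_riemann_le hc hσ (hU.2.1 p)
  have hR0 : 0 ≤ M / c + M := (abs_nonneg _).trans (hR 0)
  have hL0 : 0 ≤ L := (abs_nonneg _).trans (hGx 0)
  have hGc := hG.1.continuous
  have hGi : Integrable G := hGc.integrable_of_hasCompactSupport hG.2.1
  have hs : 0 < √h := Real.sqrt_pos.2 hh
  have hss : √h * √h = h := Real.mul_self_sqrt hh.le
  have h1 := hU.integral_posPart_increment_le hc hcM hσ hG hG0 hGt hGx hS hSv hGS hτ₀ hGτ hs hh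
  have h2 := neg_le_integral_increment hr hR hG hGx hS hSv hGS hh
  have h3 : ∫ P, G P ≤ volume.real S := by
    calc ∫ P, G P ≤ ∫ P, S.indicator (fun _ => (1 : ℝ)) P := by
          refine integral_mono hGi ?_ fun P => ?_
          · rw [integrable_indicator_iff hS]; exact integrableOn_const hSv
          · by_cases hP : P ∈ S
            · rw [indicator_of_mem hP]; exact hG1 P
            · rw [indicator_of_notMem hP, image_eq_zero_of_notMem_tsupport fun h => hP (hGS h)]
      _ = _ := by rw [integral_indicator hS, setIntegral_const, smul_eq_mul, mul_one]
  have iP := integrable_comp_translation_sub_mul hr hR hGc hG.2.1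
    (D := fun d => max d 0) (by fun_prop) (0, h) 0
  have iI := integrable_comp_translation_sub_mul hr hR hGc hG.2.1 continuous_id (0, h) 0
  simp only [add_zero, id] at iP iI
  have e1 : ∫ P, |r (P + (0, h)) - r P| * G P
      = 2 * (∫ P, max (r (P + (0, h)) - r P) 0 * G P) - ∫ P, (r (P + (0, h)) - r P) * G P := by
    rw [← integral_const_mul, ← integral_sub (iP.const_mul 2) iI]
    refine integral_congr_ae (Eventually.of_forall fun P => ?_)
    simp only
    have : ∀ d : ℝ, |d| = 2 * max d 0 - d := fun d => by
      rcases le_total 0 d with hd | hd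
      · rw [abs_of_nonneg hd, max_eq_left hd]; ring
      · rw [abs_of_nonpos hd, max_eq_right hd]; ring
    rw [this]
    ring
  have h4 : 4 * doublingBound c M * L * volume.real S * h / √h
      = 4 * doublingBound c M * L * volume.real S * √h := by
    rw [div_eq_iff hs.ne', mul_assoc _ √h, hss]
  have h5 : h ≤ √h := by
    have : √h ≤ 1 := Real.sqrt_le_one.2 hh1
    nlinarith
  have h6 : 2 * (M / c + M) * L * volume.real S * h
      ≤ 2 * (M / c + M) * L * volume.real S * √h := by gcongr
  have h7 : 2 * √h * ∫ P, G P ≤ 2 * √h * volume.real S := by gcongr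
  change ∫ P, |r (P + (0, h)) - r P| * G P ≤ _
  rw [e1]
  rw [h4] at h1
  linarith

lemma increment_le_riemann_increment {c M : ℝ} (hc : 0 < c) {p q : ℝ × ℝ}
    (hp : p ∈ Kset c M) (hq : q ∈ Kset c M) :
    |p.1 - q.1| + |p.2 - q.2| ≤ (1 + (M / c + M)) *
      (|riemann 1 p - riemann 1 q| + |riemann (-1) p - riemann (-1) q|) := by
  set R := M / c + M with hR
  have hp1 : p.1 ≠ 0 := (hc.trans_le (mem_Kset hp).1).ne'
  have hq1 : q.1 ≠ 0 := (hc.trans_le (mem_Kset hq).1).ne'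
  have key : ∀ {p : ℝ × ℝ}, p.1 ≠ 0 → p.1 = (riemann 1 p - riemann (-1) p) / 2 ∧
      p.2 = (riemann 1 p ^ 2 - riemann (-1) p ^ 2) / 4 := by
    intro p hp
    unfold riemann
    constructor
    · ring
    · field_simp; ring
  have bz := abs_riemann_le (σ := 1) hc (by norm_num) hp
  have bz' := abs_riemann_le (σ := 1) hc (by norm_num) hq
  have bw := abs_riemann_le (σ := -1) hc (by norm_num) hp
  have bw' := abs_riemann_le (σ := -1) hc (by norm_num) hq
  obtain ⟨e1, e2⟩ := key hp1
  obtain ⟨e3, e4⟩ := key hq1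
  rw [e1, e2, e3, e4]
  generalize riemann 1 p = z at *
  generalize riemann (-1) p = w at *
  generalize riemann 1 q = z' at *
  generalize riemann (-1) q = w' at *
  have hR0 : 0 ≤ R := (abs_nonneg _).trans bz
  have h1 : |(z - w) / 2 - (z' - w') / 2| ≤ (|z - z'| + |w - w'|) / 2 := by
    have : (z - w) / 2 - (z' - w') / 2 = ((z - z') - (w - w')) / 2 := by ring
    rw [this, abs_div, abs_two]
    gcongr
    exact abs_sub _ _
  have hsq : ∀ {x y : ℝ}, |x| ≤ R → |y| ≤ R → |x ^ 2 - y ^ 2| ≤ 2 * R * |x - y| := by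
    intro x y hx hy
    rw [sq_sub_sq, abs_mul]
    gcongr
    exact (abs_add_le _ _).trans (by linarith)
  have h2 : |(z ^ 2 - w ^ 2) / 4 - (z' ^ 2 - w' ^ 2) / 4| ≤ R * (|z - z'| + |w - w'|) / 2 := by
    have : (z ^ 2 - w ^ 2) / 4 - (z' ^ 2 - w' ^ 2) / 4
        = ((z ^ 2 - z' ^ 2) - (w ^ 2 - w' ^ 2)) / 4 := by ring
    rw [this, abs_div, abs_of_pos (by norm_num : (0 : ℝ) < 4)]
    have a1 := hsq bz bz'
    have a2 := hsq bw bw'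
    have a3 := abs_sub (z ^ 2 - z' ^ 2) (w ^ 2 - w' ^ 2)
    linarith
  have h3 : 0 ≤ |z - z'| + |w - w'| := by positivity
  have h4 := mul_nonneg hR0 h3
  linarith

/-- The spatial increment of a pair of functions. -/
def increment (U : ℝ × ℝ → ℝ × ℝ) (h : ℝ) (P : ℝ × ℝ) : ℝ :=
  |(U (P + (0, h))).1 - (U P).1| + |(U (P + (0, h))).2 - (U P).2|

lemma increment_nonneg (U : ℝ × ℝ → ℝ × ℝ) (h : ℝ) (P : ℝ × ℝ) : 0 ≤ increment U h P := by
  unfold increment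
  positivity

lemma increment_le {c M : ℝ} {U : ℝ × ℝ → ℝ × ℝ} (hc : 0 < c) (hU : ∀ p, U p ∈ Kset c M)
    (h : ℝ) (P : ℝ × ℝ) : increment U h P ≤ 4 * M := by
  obtain ⟨h1, h2, h3, h4⟩ := mem_Kset (hU P)
  obtain ⟨h5, h6, h7, h8⟩ := mem_Kset (hU (P + (0, h)))
  have a1 : |(U (P + (0, h))).1 - (U P).1| ≤ 2 * M := by rw [abs_le]; constructor <;> linarith
  have a2 : |(U (P + (0, h))).2 - (U P).2| ≤ 2 * M := by rw [abs_le]; constructor <;> linarith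
  unfold increment
  linarith

lemma measurable_increment {U : ℝ × ℝ → ℝ × ℝ} (hU : Measurable U) (h : ℝ) :
    Measurable (increment U h) := by
  unfold increment
  have : Measurable fun P : ℝ × ℝ => U (P + (0, h)) := hU.comp (by fun_prop)
  exact ((this.fst.sub hU.fst).norm).add ((this.snd.sub hU.snd).norm)

/-- The iterated integral of the difference quotient as an integral over a product set. -/
lemma integral_increment_div_sqrt {c M : ℝ} {U : ℝ × ℝ → ℝ × ℝ} (hUm : Measurable U) (hc : 0 < c)
    (hU : ∀ p, U p ∈ Kset c M) (δ T : ℝ) {K' : Set ℝ} (hK' : IsCompact K') (h : ℝ) :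
    (∫ t in Ioo δ T, ∫ x in K',
        (|(U (t, x + h)).1 - (U (t, x)).1| + |(U (t, x + h)).2 - (U (t, x)).2|) / √h)
      = (∫ P in Ioo δ T ×ˢ K', increment U h P) / √h := by
  have hi : IntegrableOn (increment U h) (Ioo δ T ×ˢ K') := by
    refine Measure.integrableOn_of_bounded (M := 4 * M) ?_
      (measurable_increment hUm h).aestronglyMeasurable (Eventually.of_forall fun P => ?_)
    · rw [Measure.volume_eq_prod, Measure.prod_prod]
      exact ENNReal.mul_ne_top (by simp) hK'.measure_lt_top.ne
    · rw [Real.norm_eq_abs, abs_of_nonneg (increment_nonneg U h P)]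
      exact increment_le hc hU h P
  rw [Measure.volume_eq_prod] at hi ⊢
  rw [setIntegral_prod _ hi, ← integral_div]
  simp only [← integral_div, increment, Prod.mk_add_mk, add_zero]

lemma IsEntropySolK.besov_bound {c M T : ℝ} {U : ℝ × ℝ → ℝ × ℝ}
    (hU : IsEntropySolK c M T U) (hc : 0 < c) (hcM : c < M) {δ : ℝ} (hδ : 0 < δ) (hδT : δ < T)
    {K' : Set ℝ} (hK' : IsCompact K') :
    ∃ C : ℝ, ∀ h : ℝ, 0 < h → ∫ P in Ioo δ T ×ˢ K', increment U h P ≤ C * √h := by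
  obtain ⟨L, S, hS, hSv, hcut⟩ := exists_slab_cutoff (T := T) hδ hK'
  have hM : 0 < M := hc.trans hcM
  set A := (8 * doublingBound c M * L + 4 + 2 * (M / c + M) * L) * volume.real S with hA
  set B := (1 + (M / c + M)) * (2 * A) with hB
  have hA0 : 0 ≤ A := by
    obtain ⟨G, _, _, _, _, _, hGx, _⟩ := hcut 1 one_pos
    have hL0 : 0 ≤ L := (abs_nonneg _).trans (hGx 0)
    have hN0 : 0 ≤ doublingBound c M := by unfold doublingBound; positivity
    positivity
  set k := volume.real K' with hk
  have hk0 : 0 ≤ k := measureReal_nonneg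
  refine ⟨B + 4 * M * k + 4 * M * (T * k), fun h hh => ?_⟩
  have hs : 0 < √h := Real.sqrt_pos.2 hh
  have hB0 : 0 ≤ B := by positivity
  have hT : 0 < T := hδ.trans hδT
  have hK'm := hK'.measurableSet
  have hvol : ∀ a b : ℝ, volume (Ioo a b ×ˢ K') ≠ ∞ := fun a b => by
    rw [Measure.volume_eq_prod, Measure.prod_prod]
    exact ENNReal.mul_ne_top (by simp) hK'.measure_lt_top.ne
  have hvolr : ∀ a b : ℝ, a ≤ b → volume.real (Ioo a b ×ˢ K') = (b - a) * k := fun a b hab => by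
    rw [Measure.volume_eq_prod, measureReal_prod_prod, Real.volume_real_Ioo_of_le hab]
  have hVm := measurable_increment hU.1 h
  have hVn : ∀ P, ‖increment U h P‖ ≤ 4 * M := fun P => by
    rw [Real.norm_eq_abs, abs_of_nonneg (increment_nonneg U h P)]
    exact increment_le hc hU.2.1 h P
  have hVi : IntegrableOn (increment U h) (Ioo δ T ×ˢ K') :=
    Measure.integrableOn_of_bounded (M := 4 * M) (hvol _ _) hVm.aestronglyMeasurable
      (Eventually.of_forall hVn)
  rcases lt_or_ge 1 h with hh1 | hh1
  · have h1 : ∫ P in Ioo δ T ×ˢ K', increment U h P ≤ 4 * M * ((T - δ) * k) := by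
      rw [← hvolr δ T hδT.le]
      exact (le_abs_self _).trans
        (norm_setIntegral_le_of_norm_le_const (hvol _ _).lt_top fun P _ => hVn P)
    have h2 : 1 ≤ √h := Real.one_le_sqrt.2 hh1.le
    calc _ ≤ 4 * M * ((T - δ) * k) := h1
      _ ≤ 4 * M * (T * k) := by gcongr; linarith
      _ ≤ B + 4 * M * k + 4 * M * (T * k) := by
          have : 0 ≤ 4 * M * k := by positivity
          linarith
      _ ≤ _ := le_mul_of_one_le_right (by positivity) h2
  set κ := min √h ((T - δ) / 2) with hκ
  have hκ0 : 0 < κ := lt_min hs (by linarith)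
  have hκT : κ ≤ (T - δ) / 2 := min_le_right _ _
  obtain ⟨G, τ₀, hG, hG0, hG1, hGt, hGx, hGS, hτ₀, hGτ, hGK⟩ := hcut κ hκ0
  have hGc := hG.1.continuous
  have hGi : Integrable G := hGc.integrable_of_hasCompactSupport hG.2.1
  have inc : ∀ σ : ℝ, σ ^ 2 = 1 →
      Integrable (fun P => |riemann σ (U (P + (0, h))) - riemann σ (U P)| * G P) ∧
      ∫ P, |riemann σ (U (P + (0, h))) - riemann σ (U P)| * G P ≤ A * √h := fun σ hσ => by
    refine ⟨?_, hU.integral_abs_increment_le hc hcM hσ hG hG0 hG1 hGt hGx hS hSv hGS hτ₀ hGτ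
      hh hh1⟩
    have := integrable_comp_translation_sub_mul ((measurable_riemann σ).comp hU.1)
      (fun p => abs_riemann_le hc hσ (hU.2.1 p)) hGc hG.2.1 continuous_abs (0, h) 0
    simpa using this
  obtain ⟨iz, bz⟩ := inc 1 (by norm_num)
  obtain ⟨iw, bw⟩ := inc (-1) (by norm_num)
  have hVG : Integrable fun P => increment U h P * G P :=
    hGi.bdd_mul (c := 4 * M) hVm.aestronglyMeasurable (Eventually.of_forall hVn)
  have bVG : ∫ P, increment U h P * G P ≤ B * √h := by
    calc _ ≤ ∫ P, (1 + (M / c + M)) * (|riemann 1 (U (P + (0, h))) - riemann 1 (U P)| * G P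
            + |riemann (-1) (U (P + (0, h))) - riemann (-1) (U P)| * G P) := by
          refine integral_mono hVG ((iz.add iw).const_mul _) fun P => ?_
          have := mul_le_mul_of_nonneg_right
            (increment_le_riemann_increment hc (hU.2.1 (P + (0, h))) (hU.2.1 P)) (hG0 P)
          calc _ ≤ _ := this
            _ = _ := by ring
      _ ≤ (1 + (M / c + M)) * (A * √h + A * √h) := by
          rw [integral_const_mul, integral_add iz iw]
          gcongr
      _ = _ := by rw [hB]; ring
  set J : ℝ × ℝ → ℝ := (Ioo (T - κ) T ×ˢ K').indicator fun _ => 4 * M with hJ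
  have hJm : MeasurableSet (Ioo (T - κ) T ×ˢ K') := measurableSet_Ioo.prod hK'm
  have hJi : Integrable J := by
    rw [integrable_indicator_iff hJm]; exact integrableOn_const (hvol _ _)
  have hJ0 : ∀ P, 0 ≤ J P := fun P => indicator_nonneg (fun _ _ => by positivity) P
  have bJ : ∫ P, J P ≤ 4 * M * k * √h := by
    rw [hJ, integral_indicator hJm, setIntegral_const, smul_eq_mul, hvolr _ _ (by linarith)]
    have : κ ≤ √h := min_le_left _ _
    calc (T - (T - κ)) * k * (4 * M) = 4 * M * k * κ := by ring
      _ ≤ _ := by gcongr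
  calc ∫ P in Ioo δ T ×ˢ K', increment U h P
      ≤ ∫ P in Ioo δ T ×ˢ K', (increment U h P * G P + J P) := by
        refine setIntegral_mono_on hVi (hVG.add hJi).integrableOn (measurableSet_Ioo.prod hK'm)
          fun P hP => ?_
        by_cases hPt : P.1 ≤ T - κ
        · have : G P = 1 := hGK P.1 ⟨hP.1.1.le, hPt⟩ P.2 hP.2
          rw [this, mul_one]
          linarith [hJ0 P]
        · have : J P = 4 * M := indicator_of_mem
            (show P ∈ Ioo (T - κ) T ×ˢ K' from ⟨⟨not_le.1 hPt, hP.1.2⟩, hP.2⟩) _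
          rw [this]
          have h1 := mul_nonneg (increment_nonneg U h P) (hG0 P)
          linarith [increment_le hc hU.2.1 h P]
    _ ≤ ∫ P, (increment U h P * G P + J P) :=
        setIntegral_le_integral (hVG.add hJi) (Eventually.of_forall fun P =>
          add_nonneg (mul_nonneg (increment_nonneg U h P) (hG0 P)) (hJ0 P))
    _ ≤ B * √h + 4 * M * k * √h := by
        rw [integral_add hVG hJi]
        gcongr
    _ ≤ _ := by
        have : 0 ≤ 4 * M * (T * k) * √h := by positivity
        linarith

lemma IsTestFun.integral_fderiv_apply_eq_zero {Ω : Set (ℝ × ℝ)} {φ : ℝ × ℝ → ℝ}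
    (hφ : IsTestFun Ω φ) (v : ℝ × ℝ) : ∫ p, fderiv ℝ φ p v = 0 := by
  have hi : Integrable fun p => fderiv ℝ φ p v :=
    (hφ.continuous_fderiv_apply v).integrable_of_hasCompactSupport
      (hφ.2.1.fderiv_apply (𝕜 := ℝ) v)
  have := integral_mul_fderiv_eq_neg_fderiv_mul_of_integrable (μ := (volume : Measure (ℝ × ℝ)))
    (f := fun _ => (1 : ℝ)) (g := φ) (v := v) (by simp) (by simpa using hi)
    (by simpa using hφ.1.continuous.integrable_of_hasCompactSupport hφ.2.1)
    (fun x _ => differentiableAt_const _) (fun x _ => (hφ.1.differentiable (by simp)) x)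
  simpa using this

lemma IsTestFun.comp_sub_snd {T : ℝ} {φ : ℝ × ℝ → ℝ} (hφ : IsTestFun (Slab1 T) φ) (ξ : ℝ) :
    IsTestFun (Slab1 T) fun P => φ (P - (0, ξ)) := by
  refine ⟨hφ.1.comp (contDiff_id.sub contDiff_const), ?_, ?_⟩
  · simpa [Function.comp_def, sub_eq_add_neg] using
      hφ.2.1.comp_homeomorph (Homeomorph.addRight (-((0 : ℝ), ξ)))
  · intro P hP
    have := hφ.2.2 (tsupport_comp_subset_preimage φ
      (continuous_id.sub (continuous_const (y := ((0 : ℝ), ξ)))) hP)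
    simpa [Slab1] using this

/-- A bounded function on the slab whose distributional `x`-derivative vanishes is invariant under
`x`-translations. -/
lemma ae_translation_eq_of_integral_mul_fderiv_eq_zero {T M : ℝ} {m : ℝ × ℝ → ℝ}
    (hm : Measurable m) (hmM : ∀ p, |m p| ≤ M)
    (H : ∀ φ, IsTestFun (Slab1 T) φ → ∫ p, m p * fderiv ℝ φ p (0, 1) = 0) (h : ℝ) :
    ∀ᵐ P : ℝ × ℝ, P ∈ Slab1 T → m (P + (0, h)) - m P = 0 := by
  have hM : 0 ≤ M := (abs_nonneg _).trans (hmM 0)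
  have hth : Measurable fun P : ℝ × ℝ => m (P + (0, h)) := hm.comp (measurable_id.add_const _)
  have hdm : Measurable fun P : ℝ × ℝ => m (P + (0, h)) - m P := hth.sub hm
  have hint : ∀ {r : ℝ × ℝ → ℝ}, Measurable r → (∀ p, |r p| ≤ M) → ∀ {g : ℝ × ℝ → ℝ},
      Integrable g → Integrable fun p => r p * g p := fun hr hrM _ hg =>
    hg.bdd_mul hr.aestronglyMeasurable (Eventually.of_forall hrM)
  refine IsOpen.ae_eq_zero_of_integral_contDiff_smul_eq_zero
    (isOpen_Ioo.preimage continuous_fst) ?_ fun Θ hΘ hΘc hΘs => ?_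
  · refine LocallyIntegrable.locallyIntegrableOn ?_ _
    exact (locallyIntegrable_const (2 * M)).mono hdm.aestronglyMeasurable
      (Eventually.of_forall fun P => by
        have h1 := abs_le.1 (hmM (P + (0, h)))
        have h2 := abs_le.1 (hmM P)
        rw [Real.norm_eq_abs, Real.norm_eq_abs, abs_of_nonneg (by linarith : 0 ≤ 2 * M), abs_le]
        constructor <;> linarith)
  · have hT : IsTestFun (Slab1 T) Θ := ⟨hΘ, hΘc, hΘs⟩
    have hsh : ∀ ξ, Integrable fun P : ℝ × ℝ => Θ (P - (0, ξ)) := fun ξ =>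
      (hT.comp_sub_snd ξ).1.continuous.integrable_of_hasCompactSupport (hT.comp_sub_snd ξ).2.1
    have hΘi : Integrable Θ := hΘ.continuous.integrable_of_hasCompactSupport hΘc
    have hdc := hT.continuous_fderiv_apply ((0 : ℝ), (1 : ℝ))
    have hds := hΘc.fderiv_apply (𝕜 := ℝ) ((0 : ℝ), (1 : ℝ))
    obtain ⟨B, hB⟩ := hds.exists_bound_of_continuous hdc
    obtain ⟨r, hr⟩ := hds.isCompact.isBounded.subset_closedBall 0
    have hB0 : 0 ≤ B := (norm_nonneg _).trans (hB 0)
    have key : ∀ ξ₀ : ℝ, HasDerivAt (fun ξ => ∫ P, m P * Θ (P - (0, ξ))) 0 ξ₀ := fun ξ₀ => by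
      have hd := (hasDerivAt_integral_of_dominated_loc_of_deriv_le
        (μ := (volume : Measure (ℝ × ℝ))) (s := Metric.ball ξ₀ 1)
        (F := fun ξ P => m P * Θ (P - (0, ξ)))
        (F' := fun ξ P => m P * -(fderiv ℝ Θ (P - (0, ξ)) (0, 1)))
        (bound := (Metric.closedBall (0 : ℝ × ℝ) (r + (|ξ₀| + 1))).indicator fun _ => M * B)
        (Metric.ball_mem_nhds ξ₀ one_pos)
        (Eventually.of_forall fun ξ => (hint hm hmM (hsh ξ)).aestronglyMeasurable)
        (hint hm hmM (hsh ξ₀))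
        (hm.aestronglyMeasurable.mul
          (show Continuous fun P : ℝ × ℝ => -(fderiv ℝ Θ (P - (0, ξ₀)) (0, 1)) from
            (hdc.comp (continuous_id.sub continuous_const)).neg).aestronglyMeasurable)
        (Eventually.of_forall fun P ξ hξ => ?_)
        ((integrable_indicator_iff Metric.isClosed_closedBall.measurableSet).2
          (integrableOn_const (isCompact_closedBall _ _).measure_lt_top.ne))
        (Eventually.of_forall fun P ξ _ => ?_)).2
      · have := H _ (hT.comp_sub_snd ξ₀)
        simp only [fderiv_comp_sub] at this
        simp only [mul_neg, integral_neg, this, neg_zero] at hd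
        exact hd
      · by_cases hP : P ∈ Metric.closedBall (0 : ℝ × ℝ) (r + (|ξ₀| + 1))
        · rw [indicator_of_mem hP, norm_mul, norm_neg]
          exact mul_le_mul (hmM P) (hB _) (norm_nonneg _) hM
        · rw [indicator_of_notMem hP]
          have : fderiv ℝ Θ (P - (0, ξ)) (0, 1) = 0 := by
            by_contra hne
            have h1 := hr (subset_tsupport _ hne)
            refine hP ?_
            rw [mem_closedBall_zero_iff] at h1 ⊢
            have h2 : ‖((0 : ℝ), ξ)‖ ≤ |ξ₀| + 1 := by
              rw [Prod.norm_mk, norm_zero, max_eq_right (norm_nonneg _), Real.norm_eq_abs]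
              have h3 : |ξ - ξ₀| < 1 := by simpa [Real.dist_eq] using hξ
              linarith [abs_sub_abs_le_abs_sub ξ ξ₀]
            calc ‖P‖ = ‖(P - (0, ξ)) + (0, ξ)‖ := by rw [sub_add_cancel]
              _ ≤ _ := (norm_add_le _ _).trans (add_le_add h1 h2)
          simp [this]
      · have h1 : HasDerivAt (fun ξ : ℝ => P - ((0 : ℝ), ξ)) (-((0 : ℝ), (1 : ℝ))) ξ :=
          ((hasDerivAt_const ξ (0 : ℝ)).prodMk (hasDerivAt_id ξ)).const_sub P
        have h2 := (hΘ.differentiable (by simp) (P - (0, ξ))).hasFDerivAt.comp_hasDerivAt ξ h1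
        rw [map_neg] at h2
        exact h2.const_mul _
    have hconst : ∫ P, m P * Θ (P - (0, h)) = ∫ P, m P * Θ P := by
      have := is_const_of_deriv_eq_zero (fun ξ => (key ξ).differentiableAt)
        (fun ξ => (key ξ).deriv) h 0
      simpa [← Prod.zero_eq_mk] using this
    have htr : ∫ P, m (P + (0, h)) * Θ P = ∫ P, m P * Θ (P - (0, h)) := by
      rw [← integral_add_right_eq_self (fun P => m P * Θ (P - (0, h))) ((0 : ℝ), h)]
      simp only [add_sub_cancel_right]
    simp only [smul_eq_mul, mul_comm (Θ _), sub_mul]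
    rw [integral_sub (hint hth (fun p => hmM _) hΘi) (hint hm hmM hΘi), htr, hconst, sub_self]

/-- If `c = M` the density is constant, and the solution does not depend on `x`. -/
lemma IsEntropySolK.setIntegral_increment_eq_zero {M T : ℝ} {U : ℝ × ℝ → ℝ × ℝ}
    (hU : IsEntropySolK M M T U) {δ : ℝ} (hδ : 0 < δ) (K' : Set ℝ) (h : ℝ) :
    ∫ P in Ioo δ T ×ˢ K', increment U h P = 0 := by
  have hρ : ∀ p, (U p).1 = M := fun p =>
    le_antisymm (mem_Kset (hU.2.1 p)).2.1 (mem_Kset (hU.2.1 p)).1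
  have hm : Measurable fun p => (U p).2 := measurable_snd.comp hU.1
  have hmM : ∀ p, |(U p).2| ≤ M := fun p =>
    abs_le.2 ⟨(mem_Kset (hU.2.1 p)).2.2.1, (mem_Kset (hU.2.1 p)).2.2.2⟩
  have H : ∀ φ, IsTestFun (Slab1 T) φ → ∫ p, (U p).2 * fderiv ℝ φ p (0, 1) = 0 := fun φ hφ => by
    have h1 := (hU.2.2.1 φ hφ).1
    have hi : ∀ v, Integrable fun p => fderiv ℝ φ p v := fun v =>
      (hφ.continuous_fderiv_apply v).integrable_of_hasCompactSupport
        (hφ.2.1.fderiv_apply (𝕜 := ℝ) v)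
    rw [hφ.setIntegral_eq (fun p => (U p).1) (fun p => (U p).2)] at h1
    simp only [hρ] at h1
    rw [integral_add ((hi _).const_mul M)
      ((hi _).bdd_mul hm.aestronglyMeasurable (Eventually.of_forall hmM)), integral_const_mul,
      hφ.integral_fderiv_apply_eq_zero, mul_zero, zero_add] at h1
    exact h1
  refine setIntegral_eq_zero_of_ae_eq_zero ?_
  filter_upwards [ae_translation_eq_of_integral_mul_fderiv_eq_zero hm hmM H h] with P hP hPK
  have := hP (show P ∈ Slab1 T from ⟨hδ.trans hPK.1.1, hPK.1.2⟩)
  simp [increment, hρ, this]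

/-- Entropy solutions in `K` of the isentropic Euler system with
`γ = 3` belong to `B^{1/2,1}_{∞,loc}` in space, locally in time away from `t = 0`. -/
theorem statement16 (c M T : ℝ) (hc : 0 < c) (hcM : c ≤ M) (hT : 0 < T)
    (U : ℝ × ℝ → ℝ × ℝ) (hU : IsEntropySolK c M T U) :
    ∀ δ : ℝ, 0 < δ → δ < T → ∀ K' : Set ℝ, IsCompact K' →
      ∃ C : ℝ, ∀ h : ℝ, 0 < h →
        (∫ t in Set.Ioo δ T, ∫ x in K',
            (|(U (t, x + h)).1 - (U (t, x)).1| + |(U (t, x + h)).2 - (U (t, x)).2|)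
              / Real.sqrt h)
          ≤ C := by
  intro δ hδ hδT K' hK'
  obtain ⟨C, hC⟩ : ∃ C, ∀ h, 0 < h → ∫ P in Ioo δ T ×ˢ K', increment U h P ≤ C * √h := by
    rcases hcM.lt_or_eq with hlt | rfl
    · exact hU.besov_bound hc hlt hδ hδT hK'
    · exact ⟨0, fun h _ => by rw [hU.setIntegral_increment_eq_zero hδ K' h, zero_mul]⟩
  refine ⟨C, fun h hh => ?_⟩
  rw [integral_increment_div_sqrt hU.1 hc hU.2.1 δ T hK' h, div_le_iff₀ (Real.sqrt_pos.2 hh)]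
  exact hC h hh
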